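/- arXiv:2507.05792 — 7 statements merged into one kernel-verified Lean document; each statement's English description precedes it below -/
import Mathlib

section
/- Let m ≥ 1 and let A be a positive definite real symmetric m×m matrix. Then min(A) ≤ (4/3)^{(m−1)/2} · (det A)^{1/m}, where min(A) is the minimum of xᵀAx over nonzero integer vectors x ∈ ℤ^m. -/
open Matrix

/-- The value `A[x] = xᵀ A x` of the quadratic form of `A` at an integer vector `x`. -/
def qVal {m : ℕ} (A : Matrix (Fin m) (Fin m) ℝ) (x : Fin m → ℤ) : ℝ :=
  dotProduct (fun i => (x i : ℝ)) (A *ᵥ fun i => (x i : ℝ))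

/-- `min(A)`, the infimum of `A[x]` over nonzero integer vectors. -/
noncomputable def minOf {m : ℕ} (A : Matrix (Fin m) (Fin m) ℝ) : ℝ :=
  sInf {r : ℝ | ∃ x : Fin m → ℤ, x ≠ 0 ∧ r = qVal A x}

/-- `Min(A)`, the set of integer vectors realizing `min(A)`. -/
def minSet {m : ℕ} (A : Matrix (Fin m) (Fin m) ℝ) : Set (Fin m → ℤ) :=
  {x : Fin m → ℤ | qVal A x = minOf A}

/-- The diagonal entries of the matrices `UᵀAU` with `U` integral and unimodular. -/
def unimodularValues {ι : Type*} [Fintype ι] [DecidableEq ι] (A : Matrix ι ι ℝ) : Set ℝ :=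
  {r : ℝ | ∃ U : Matrix ι ι ℤ, IsUnit U.det ∧
    ∃ i, r = ((U.map (Int.castRingHom ℝ))ᵀ * A * U.map (Int.castRingHom ℝ)) i i}

theorem transpose_mul_mul_apply_self {ι : Type*} [Fintype ι] (M W : Matrix ι ι ℝ) (j : ι) :
    (Wᵀ * M * W) j j = (fun i => W i j) ᵥ* M ⬝ᵥ (fun i => W i j) := rfl

section unimodularValues

variable {ι κ : Type*} [Fintype ι] [DecidableEq ι] [Fintype κ] [DecidableEq κ]

theorem det_map_intCast_sq {U : Matrix ι ι ℤ} (hU : IsUnit U.det) :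
    (U.map (Int.castRingHom ℝ)).det ^ 2 = 1 := by
  rw [← RingHom.mapMatrix_apply, ← RingHom.map_det, ← map_pow, Int.isUnit_sq hU, map_one]

theorem posDef_unimodular_congr {A : Matrix ι ι ℝ} (hA : A.PosDef) {U : Matrix ι ι ℤ}
    (hU : IsUnit U.det) :
    ((U.map (Int.castRingHom ℝ))ᵀ * A * U.map (Int.castRingHom ℝ)).PosDef := by
  have hunit : IsUnit (U.map (Int.castRingHom ℝ)) := by
    rw [Matrix.isUnit_iff_isUnit_det, isUnit_iff_ne_zero]
    intro h
    have hsq := det_map_intCast_sq hU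
    rw [h] at hsq
    norm_num at hsq
  exact hA.conjTranspose_mul_mul_same (Matrix.mulVec_injective_of_isUnit hunit)

theorem pos_of_mem_unimodularValues {A : Matrix ι ι ℝ} (hA : A.PosDef) {r : ℝ}
    (hr : r ∈ unimodularValues A) : 0 < r := by
  obtain ⟨U, hU, i, rfl⟩ := hr
  exact (posDef_unimodular_congr hA hU).diag_pos

theorem bddBelow_unimodularValues {A : Matrix ι ι ℝ} (hA : A.PosDef) :
    BddBelow (unimodularValues A) :=
  ⟨0, fun _ hr => (pos_of_mem_unimodularValues hA hr).le⟩

theorem unimodularValues_nonempty [Nonempty ι] (A : Matrix ι ι ℝ) :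
    (unimodularValues A).Nonempty :=
  ⟨_, 1, by simp, Classical.arbitrary ι, rfl⟩

theorem sInf_unimodularValues_nonneg {A : Matrix ι ι ℝ} (hA : A.PosDef) :
    0 ≤ sInf (unimodularValues A) :=
  Real.sInf_nonneg fun _ hr => (pos_of_mem_unimodularValues hA hr).le

theorem unimodularValues_congr_subset (A : Matrix ι ι ℝ) {U : Matrix ι ι ℤ} (hU : IsUnit U.det)
    (e : κ ≃ ι) :
    unimodularValues
      (((U.map (Int.castRingHom ℝ))ᵀ * A * U.map (Int.castRingHom ℝ)).submatrix e e) ⊆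
      unimodularValues A := by
  rintro _ ⟨W, hW, j, rfl⟩
  refine ⟨U * W.submatrix e.symm e.symm, ?_, e j, ?_⟩
  · rw [Matrix.det_mul, Matrix.det_submatrix_equiv_self]
    exact hU.mul hW
  · set R := U.map (Int.castRingHom ℝ)
    have hmap : (U * W.submatrix e.symm e.symm).map (Int.castRingHom ℝ) =
        R * (W.map (Int.castRingHom ℝ)).submatrix e.symm e.symm := by
      rw [Matrix.map_mul, Matrix.submatrix_map]
    have hW' : W.map (Int.castRingHom ℝ) =
        ((W.map (Int.castRingHom ℝ)).submatrix e.symm e.symm).submatrix e e := by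
      simp
    rw [hmap]
    conv_lhs => rw [hW']
    rw [Matrix.transpose_submatrix, Matrix.submatrix_mul_equiv, Matrix.submatrix_mul_equiv,
      Matrix.submatrix_apply, Matrix.transpose_mul]
    simp only [Matrix.mul_assoc]

/-- Complete the square in the first variable and round. -/
theorem sInf_unimodularValues_fromBlocks_le (a : Matrix Unit Unit ℝ) (b : Matrix Unit κ ℝ)
    (D : Matrix κ κ ℝ) [Invertible a] (hM : (fromBlocks a b bᴴ D).PosDef) {s : ℝ}
    (hs : s ∈ unimodularValues (D - bᴴ * a⁻¹ * b)) :
    sInf (unimodularValues (fromBlocks a b bᴴ D)) ≤ a () () / 4 + s := by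
  obtain ⟨V, hV, j, rfl⟩ := hs
  have ha : a.IsHermitian := (Matrix.isHermitian_fromBlocks_iff.1 hM.isHermitian).1
  have ha0 : 0 < a () () := hM.diag_pos (i := Sum.inl ())
  set y : κ → ℝ := fun i => (V i j : ℝ)
  set c : ℝ := ((a⁻¹ * b) *ᵥ y) ()
  have hmem : (c - round c) ^ 2 * a () () +
      ((V.map (Int.castRingHom ℝ))ᵀ * (D - bᴴ * a⁻¹ * b) * V.map (Int.castRingHom ℝ)) j j ∈
      unimodularValues (fromBlocks a b bᴴ D) := by
    refine ⟨fromBlocks 1 (Matrix.of fun _ _ => -round c) 0 V, ?_, Sum.inr j, ?_⟩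
    · simpa [Matrix.det_fromBlocks_zero₂₁] using hV
    · rw [transpose_mul_mul_apply_self, transpose_mul_mul_apply_self]
      have hcol : (fun i => ((fromBlocks (1 : Matrix Unit Unit ℤ)
          (Matrix.of fun _ _ => -round c) 0 V).map (Int.castRingHom ℝ)) i (Sum.inr j)) =
          Sum.elim (fun _ : Unit => -(round c : ℝ)) y := by
        ext (i | i) <;> simp [y]
      have hsq := Matrix.schur_complement_eq₁₁ b D (fun _ : Unit => -(round c : ℝ)) y ha
      rw [star_trivial, star_trivial, star_trivial] at hsq
      rw [hcol, hsq]
      congr 1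
      simp only [dotProduct, Matrix.vecMul, Finset.univ_unique, Finset.sum_singleton,
        Pi.add_apply, PUnit.default_eq_unit]
      change _ = (-(round c : ℝ) + c) * a () () * (-(round c : ℝ) + c)
      ring
  refine (csInf_le (bddBelow_unimodularValues hM) hmem).trans ?_
  have hround : (c - round c) ^ 2 ≤ 1 / 4 := by
    have h := abs_le.1 (abs_sub_round c)
    nlinarith [h.1, h.2]
  nlinarith

end unimodularValues

theorem posDef_schur_complement {ι κ : Type*} [Fintype ι] [DecidableEq ι] [Fintype κ]
    [DecidableEq κ] {a : Matrix ι ι ℝ} {b : Matrix ι κ ℝ} {D : Matrix κ κ ℝ} [Invertible a]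
    (hM : (fromBlocks a b bᴴ D).PosDef) : (D - bᴴ * a⁻¹ * b).PosDef := by
  have ha : a.PosDef := hM.submatrix (e := Sum.inl) Sum.inl_injective
  have hsemi := (Matrix.PosDef.fromBlocks₁₁ b D ha).1 hM.posSemidef
  refine hsemi.posDef_iff_isUnit.2 ?_
  rw [Matrix.isUnit_iff_isUnit_det, isUnit_iff_ne_zero]
  intro h
  have hdet := hM.det_pos
  rw [Matrix.det_fromBlocks₁₁, Matrix.invOf_eq_nonsing_inv, h, mul_zero] at hdet
  exact hdet.false

theorem exists_sumUnit_equiv_apply_inl {n : ℕ} (i : Fin (n + 1)) :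
    ∃ e : Unit ⊕ Fin n ≃ Fin (n + 1), e (Sum.inl ()) = i := by
  let e₀ : Unit ⊕ Fin n ≃ Fin (n + 1) := Fintype.equivOfCardEq (by simp [add_comm])
  exact ⟨e₀.trans (Equiv.swap (e₀ (Sum.inl ())) i), by simp⟩

theorem sInf_unimodularValues_pow_le_det (n : ℕ) (A : Matrix (Fin n) (Fin n) ℝ) (hA : A.PosDef) :
    sInf (unimodularValues A) ^ n ≤ (4 / 3 : ℝ) ^ n.choose 2 * A.det := by
  induction n with
  | zero => simp
  | succ n ih =>
    set T := sInf (unimodularValues A)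
    have hT0 : 0 ≤ T := sInf_unimodularValues_nonneg hA
    rcases n.eq_zero_or_pos with rfl | hn
    · have : A 0 0 ∈ unimodularValues A := ⟨1, by simp, 0, by simp⟩
      simpa using csInf_le (bddBelow_unimodularValues hA) this
    have : Nonempty (Fin n) := ⟨⟨0, hn⟩⟩
    have key : ∀ r ∈ unimodularValues A,
        max 0 (T - r / 4) ^ n * T ≤ (4 / 3 : ℝ) ^ n.choose 2 * A.det := by
      intro r hr
      have hTr : T ≤ r := csInf_le (bddBelow_unimodularValues hA) hr
      have hr0 : 0 < r := pos_of_mem_unimodularValues hA hr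
      obtain ⟨U, hU, i, hri⟩ := hr
      obtain ⟨e, he⟩ := exists_sumUnit_equiv_apply_inl i
      have hsub := unimodularValues_congr_subset A hU e
      set M := ((U.map (Int.castRingHom ℝ))ᵀ * A * U.map (Int.castRingHom ℝ)).submatrix e e
        with hMdef
      have hM : M.PosDef := (posDef_unimodular_congr hA hU).submatrix e.injective
      have hdetM : M.det = A.det := by
        rw [hMdef, Matrix.det_submatrix_equiv_self, Matrix.det_mul, Matrix.det_mul,
          Matrix.det_transpose]
        linear_combination A.det * det_map_intCast_sq hU
      have hb : M.toBlocks₂₁ = M.toBlocks₁₂ᴴ := by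
        ext p q
        exact (hM.isHermitian.apply (Sum.inr p) (Sum.inl q)).symm
      set a := M.toBlocks₁₁
      set b := M.toBlocks₁₂
      set D := M.toBlocks₂₂
      have hblocks : M = fromBlocks a b bᴴ D := by
        rw [← hb, Matrix.fromBlocks_toBlocks]
      have har : a () () = r := by
        rw [hri, ← he]
        rfl
      have hdeta : a.det = r := by
        rw [Matrix.det_unique, ← har]
      have : Invertible a := Matrix.invertibleOfIsUnitDet a (by
        rw [hdeta]
        exact hr0.ne'.isUnit)
      rw [hblocks] at hM hdetM hsub
      have hS := posDef_schur_complement hM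
      have hdet : r * (D - bᴴ * a⁻¹ * b).det = A.det := by
        rw [← hdetM, Matrix.det_fromBlocks₁₁, hdeta, Matrix.invOf_eq_nonsing_inv]
      set t := sInf (unimodularValues (D - bᴴ * a⁻¹ * b))
      have ht0 : 0 ≤ t := sInf_unimodularValues_nonneg hS
      have hle : T - r / 4 ≤ t := by
        refine le_csInf (unimodularValues_nonempty _) fun s hs => ?_
        have h₁ := sInf_unimodularValues_fromBlocks_le a b D hM hs
        have h₂ := csInf_le_csInf (bddBelow_unimodularValues hA)
          (unimodularValues_nonempty _) hsub
        rw [har] at h₁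
        linarith
      calc max 0 (T - r / 4) ^ n * T ≤ t ^ n * r := by
            gcongr
            exact max_le ht0 hle
        _ ≤ (4 / 3 : ℝ) ^ n.choose 2 * (D - bᴴ * a⁻¹ * b).det * r := by
            gcongr
            exact ih _ hS
        _ = (4 / 3 : ℝ) ^ n.choose 2 * A.det := by
            rw [← hdet]
            ring
    have hclosed : IsClosed {r : ℝ |
        max 0 (T - r / 4) ^ n * T ≤ (4 / 3 : ℝ) ^ n.choose 2 * A.det} :=
      isClosed_le (by fun_prop) continuous_const
    have hlim : max 0 (T - T / 4) ^ n * T ≤ (4 / 3 : ℝ) ^ n.choose 2 * A.det :=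
      closure_minimal key hclosed
        (csInf_mem_closure (unimodularValues_nonempty A) (bddBelow_unimodularValues hA))
    rw [max_eq_right (by linarith), show T - T / 4 = 3 / 4 * T by ring, mul_pow] at hlim
    have hmul := mul_le_mul_of_nonneg_left hlim (show (0 : ℝ) ≤ (4 / 3) ^ n by positivity)
    have hone : (4 / 3 : ℝ) ^ n * (3 / 4) ^ n = 1 := by
      rw [← mul_pow]
      norm_num
    have hchoose : (n + 1).choose 2 = n + n.choose 2 := by
      rw [Nat.choose_succ_succ' n 1, Nat.choose_one_right]
    rw [hchoose, pow_add (4 / 3 : ℝ)]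
    calc T ^ (n + 1) = (4 / 3 : ℝ) ^ n * ((3 / 4) ^ n * T ^ n * T) := by
          rw [pow_succ]
          linear_combination (-(T ^ n * T)) * hone
      _ ≤ _ := by linarith

theorem minOf_nonneg {m : ℕ} {A : Matrix (Fin m) (Fin m) ℝ} (hA : A.PosDef) : 0 ≤ minOf A := by
  refine Real.sInf_nonneg ?_
  rintro _ ⟨x, -, rfl⟩
  exact hA.posSemidef.dotProduct_mulVec_nonneg _

theorem minOf_le_of_mem_unimodularValues {m : ℕ} {A : Matrix (Fin m) (Fin m) ℝ} (hA : A.PosDef)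
    {r : ℝ} (hr : r ∈ unimodularValues A) : minOf A ≤ r := by
  obtain ⟨U, hU, i, rfl⟩ := hr
  refine csInf_le ⟨0, ?_⟩ ⟨fun k => U k i, fun h => ?_, ?_⟩
  · rintro _ ⟨x, -, rfl⟩
    exact hA.posSemidef.dotProduct_mulVec_nonneg _
  · exact hU.ne_zero (Matrix.det_eq_zero_of_column_eq_zero i (congrFun h))
  · rw [transpose_mul_mul_apply_self, ← Matrix.dotProduct_mulVec]
    rfl

/-- Hermite's inequality: for a positive definite real symmetric `m×m` matrix `A`,
`min(A) ≤ (4/3)^((m-1)/2) · (det A)^(1/m)`. -/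
theorem hermite_inequality (m : ℕ) (hm : 1 ≤ m)
    (A : Matrix (Fin m) (Fin m) ℝ) (hA : A.PosDef) :
    minOf A ≤ (4 / 3 : ℝ) ^ (((m : ℝ) - 1) / 2) * A.det ^ ((1 : ℝ) / m) := by
  have hm0 : (m : ℝ) ≠ 0 := by
    exact_mod_cast (by omega : m ≠ 0)
  have : Nonempty (Fin m) := ⟨⟨0, hm⟩⟩
  have hmin : minOf A ≤ sInf (unimodularValues A) :=
    le_csInf (unimodularValues_nonempty A) fun _ hr => minOf_le_of_mem_unimodularValues hA hr
  have hpow : minOf A ^ m ≤ (4 / 3 : ℝ) ^ m.choose 2 * A.det :=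
    (pow_le_pow_left₀ (minOf_nonneg hA) hmin m).trans (sInf_unimodularValues_pow_le_det m A hA)
  have hroot := Real.rpow_le_rpow (pow_nonneg (minOf_nonneg hA) m) hpow
    (show (0 : ℝ) ≤ 1 / m by positivity)
  rw [Real.mul_rpow (by positivity) hA.det_pos.le, ← Real.rpow_natCast, ← Real.rpow_natCast,
    ← Real.rpow_mul (minOf_nonneg hA), ← Real.rpow_mul (by norm_num), mul_one_div_cancel hm0,
    Real.rpow_one, Nat.cast_choose_two] at hroot
  rwa [show (m : ℝ) * (m - 1) / 2 * (1 / m) = (m - 1) / 2 by field_simp] at hroot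
end

section
/- Let m ≥ 1 and let A be a positive definite real symmetric m×m matrix. Then A is perfect (i.e. the rank-one matrices x xᵀ with x ∈ Min(A) span the real vector space Sym_m(ℝ)) if and only if A is uniquely determined by min(A) and Min(A), i.e. if and only if every positive definite real symmetric m×m matrix B with min(B) = min(A) and Min(B) = Min(A) satisfies B = A. -/
open Matrix

/-- The submodule of symmetric matrices `Sym_m(ℝ)` inside the space of all real
`m×m` matrices. -/
def symSubmodule (m : ℕ) : Submodule ℝ (Matrix (Fin m) (Fin m) ℝ) where
  carrier := {M | M.IsSymm}
  add_mem' := fun ha hb => ha.add hb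
  zero_mem' := Matrix.isSymm_zero
  smul_mem' := fun c M h => by
    show (c • M)ᵀ = c • M
    rw [Matrix.transpose_smul, h]

/-- `A` is perfect: the rank-one matrices `x xᵀ`, `x ∈ Min(A)`, span `Sym_m(ℝ)`. -/
def IsPerfectForm {m : ℕ} (A : Matrix (Fin m) (Fin m) ℝ) : Prop :=
  Submodule.span ℝ
      ((fun x : Fin m → ℤ =>
        vecMulVec (fun i => (x i : ℝ)) (fun i => (x i : ℝ))) '' minSet A)
    = symSubmodule m

theorem dotProduct_mulVec_eq_norm_sq_mul {m : ℕ} (M : Matrix (Fin m) (Fin m) ℝ)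
    (y : Fin m → ℝ) :
    y ⬝ᵥ M *ᵥ y = ‖y‖ ^ 2 * ((‖y‖⁻¹ • y) ⬝ᵥ M *ᵥ (‖y‖⁻¹ • y)) := by
  rcases eq_or_ne y 0 with rfl | hy
  · simp
  · have h : ‖y‖ ≠ 0 := norm_ne_zero_iff.mpr hy
    simp only [mulVec_smul, smul_dotProduct, dotProduct_smul, smul_eq_mul]
    field_simp

theorem norm_inv_smul_mem_sphere {m : ℕ} {y : Fin m → ℝ} (hy : y ≠ 0) :
    ‖y‖⁻¹ • y ∈ Metric.sphere (0 : Fin m → ℝ) 1 := by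
  have h : ‖y‖ ≠ 0 := norm_ne_zero_iff.mpr hy
  simp [norm_smul, h]

theorem continuousOn_dotProduct_mulVec {m : ℕ} (M : Matrix (Fin m) (Fin m) ℝ)
    (s : Set (Fin m → ℝ)) : ContinuousOn (fun y => y ⬝ᵥ M *ᵥ y) s := by
  apply Continuous.continuousOn
  fun_prop

theorem exists_abs_dotProduct_mulVec_le {m : ℕ} (M : Matrix (Fin m) (Fin m) ℝ) :
    ∃ C : ℝ, ∀ y : Fin m → ℝ, |y ⬝ᵥ M *ᵥ y| ≤ C * ‖y‖ ^ 2 := by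
  obtain ⟨C, hC⟩ := (isCompact_sphere (0 : Fin m → ℝ) 1).exists_bound_of_continuousOn
    (continuousOn_dotProduct_mulVec M _)
  refine ⟨C, fun y => ?_⟩
  rcases eq_or_ne y 0 with rfl | hy
  · simp
  · rw [dotProduct_mulVec_eq_norm_sq_mul, abs_mul, abs_of_nonneg (sq_nonneg ‖y‖), mul_comm]
    exact mul_le_mul_of_nonneg_right (hC _ (norm_inv_smul_mem_sphere hy)) (sq_nonneg _)

theorem Matrix.PosDef.exists_mul_norm_sq_le {m : ℕ} {A : Matrix (Fin m) (Fin m) ℝ}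
    (hA : A.PosDef) :
    ∃ c : ℝ, 0 < c ∧ ∀ y : Fin m → ℝ, c * ‖y‖ ^ 2 ≤ y ⬝ᵥ A *ᵥ y := by
  rcases (Metric.sphere (0 : Fin m → ℝ) 1).eq_empty_or_nonempty with he | hne
  · refine ⟨1, one_pos, fun y => ?_⟩
    rcases eq_or_ne y 0 with rfl | hy
    · simp
    · exact absurd (norm_inv_smul_mem_sphere hy) (by simp [he])
  · obtain ⟨u, hu, hmin⟩ := (isCompact_sphere (0 : Fin m → ℝ) 1).exists_isMinOn hne
      (continuousOn_dotProduct_mulVec A _)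
    have hu0 : u ≠ 0 := Metric.ne_of_mem_sphere hu one_ne_zero
    refine ⟨u ⬝ᵥ A *ᵥ u, by simpa using hA.dotProduct_mulVec_pos hu0, fun y => ?_⟩
    rcases eq_or_ne y 0 with rfl | hy
    · simp
    · rw [dotProduct_mulVec_eq_norm_sq_mul A y, mul_comm]
      exact mul_le_mul_of_nonneg_left
        (isMinOn_iff.mp hmin _ (norm_inv_smul_mem_sphere hy)) (sq_nonneg _)

theorem intCast_vec_ne_zero {m : ℕ} {x : Fin m → ℤ} (hx : x ≠ 0) :
    (fun i => (x i : ℝ)) ≠ 0 := by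
  contrapose! hx
  ext i
  simpa using congrFun hx i

theorem qVal_pos {m : ℕ} {A : Matrix (Fin m) (Fin m) ℝ} (hA : A.PosDef) {x : Fin m → ℤ}
    (hx : x ≠ 0) : 0 < qVal A x := by
  simpa [qVal] using hA.dotProduct_mulVec_pos (intCast_vec_ne_zero hx)

theorem finite_setOf_mul_norm_sq_le {m : ℕ} {c : ℝ} (hc : 0 < c) (R : ℝ) :
    {x : Fin m → ℤ | c * ‖fun i => (x i : ℝ)‖ ^ 2 ≤ R}.Finite := by
  obtain ⟨N, hN⟩ := exists_nat_ge (R / c + 1)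
  refine (Set.finite_Icc (fun _ : Fin m => -(N : ℤ)) (fun _ => (N : ℤ))).subset fun x hx => ?_
  have hx' : ‖fun i => (x i : ℝ)‖ ^ 2 ≤ R / c := by
    rw [le_div_iff₀ hc, mul_comm]
    exact hx
  have hn : ‖fun i => (x i : ℝ)‖ ≤ N := by
    nlinarith [sq_nonneg (‖fun i => (x i : ℝ)‖ - 1)]
  have hi (i : Fin m) : |x i| ≤ (N : ℤ) := by
    have := (norm_le_pi_norm (fun i => (x i : ℝ)) i).trans hn
    rw [Real.norm_eq_abs] at this
    exact_mod_cast this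
  exact ⟨fun i => (abs_le.mp (hi i)).1, fun i => (abs_le.mp (hi i)).2⟩

theorem finite_setOf_qVal_le {m : ℕ} {A : Matrix (Fin m) (Fin m) ℝ} (hA : A.PosDef) (R : ℝ) :
    {x : Fin m → ℤ | qVal A x ≤ R}.Finite := by
  obtain ⟨c, hc, h⟩ := hA.exists_mul_norm_sq_le
  exact (finite_setOf_mul_norm_sq_le hc R).subset fun x hx => (h _).trans hx

theorem minOf_eq_of_forall_le {m : ℕ} {A : Matrix (Fin m) (Fin m) ℝ} {x : Fin m → ℤ}
    (hx : x ≠ 0) (h : ∀ y : Fin m → ℤ, y ≠ 0 → qVal A x ≤ qVal A y) : minOf A = qVal A x := by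
  refine IsLeast.csInf_eq ⟨⟨x, hx, rfl⟩, ?_⟩
  rintro _ ⟨y, hy, rfl⟩
  exact h y hy

theorem exists_ne_zero_minOf_eq {m : ℕ} (hm : 1 ≤ m) {A : Matrix (Fin m) (Fin m) ℝ}
    (hA : A.PosDef) :
    ∃ x : Fin m → ℤ, x ≠ 0 ∧ minOf A = qVal A x ∧ ∀ y : Fin m → ℤ, y ≠ 0 → qVal A x ≤ qVal A y := by
  have : Nonempty (Fin m) := ⟨⟨0, hm⟩⟩
  obtain ⟨x₁, hx₁⟩ := exists_ne (0 : Fin m → ℤ)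
  obtain ⟨x, ⟨hxle, hx0⟩, hmin⟩ := Set.exists_min_image
    ({x : Fin m → ℤ | qVal A x ≤ qVal A x₁} ∩ {x | x ≠ 0}) (qVal A)
    ((finite_setOf_qVal_le hA _).inter_of_left _) ⟨x₁, le_refl (qVal A x₁), hx₁⟩
  have h (y : Fin m → ℤ) (hy : y ≠ 0) : qVal A x ≤ qVal A y := by
    rcases le_total (qVal A y) (qVal A x₁) with hle | hle
    · exact hmin y ⟨hle, hy⟩
    · exact le_trans hxle hle
  exact ⟨x, hx0, minOf_eq_of_forall_le hx0 h, h⟩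

theorem qVal_add_smul {m : ℕ} (A H : Matrix (Fin m) (Fin m) ℝ) (t : ℝ) (x : Fin m → ℤ) :
    qVal (A + t • H) x = qVal A x + t * qVal H x := by
  simp [qVal, add_mulVec, smul_mulVec, dotProduct_add, dotProduct_smul]

theorem qVal_zero {m : ℕ} (A : Matrix (Fin m) (Fin m) ℝ) : qVal A 0 = 0 := by
  simp [qVal, dotProduct]

/-- A symmetric matrix vanishing on `Min(A)` is a direction in which `A` can be perturbed without
changing `min(A)` and `Min(A)`. -/
theorem exists_pos_perturbation {m : ℕ} (hm : 1 ≤ m) {A H : Matrix (Fin m) (Fin m) ℝ}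
    (hA : A.PosDef) (hH : H.IsSymm) (hmin : ∀ x ∈ minSet A, qVal H x = 0) :
    ∃ t : ℝ, 0 < t ∧ (A + t • H).PosDef ∧ minOf (A + t • H) = minOf A ∧
      minSet (A + t • H) = minSet A := by
  obtain ⟨c, hc, hcA⟩ := hA.exists_mul_norm_sq_le
  obtain ⟨C, hC⟩ := exists_abs_dotProduct_mulVec_le H
  obtain ⟨x₀, hx₀, hμ, hle⟩ := exists_ne_zero_minOf_eq hm hA
  have hfin := finite_setOf_mul_norm_sq_le (m := m) (half_pos hc) (minOf A)
  have hsmall : ∀ᶠ t : ℝ in nhds 0, t * C < c / 2 := by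
    have : ContinuousAt (fun t : ℝ => t * C) 0 := by fun_prop
    exact this.eventually_lt_const (by simpa using hc)
  have hlocal : ∀ᶠ t : ℝ in nhds 0, ∀ x ∈ {x : Fin m → ℤ | c / 2 * ‖fun i => (x i : ℝ)‖ ^ 2
      ≤ minOf A}, minOf A < qVal A x → minOf A < qVal A x + t * qVal H x := by
    refine (Filter.eventually_all_finite hfin).mpr fun x _ => ?_
    by_cases hx : minOf A < qVal A x
    · have : ContinuousAt (fun t : ℝ => qVal A x + t * qVal H x) 0 := by fun_prop
      filter_upwards [this.eventually_const_lt (by simpa using hx)] with t ht _ using ht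
    · exact Filter.Eventually.of_forall fun t h => absurd h hx
  obtain ⟨t, ⟨htC, htx⟩, ht : 0 < t⟩ :=
    (((hsmall.and hlocal).filter_mono nhdsWithin_le_nhds).and
      (self_mem_nhdsWithin : Set.Ioi (0 : ℝ) ∈ nhdsWithin 0 (Set.Ioi 0))).exists
  have hlow (y : Fin m → ℝ) : c / 2 * ‖y‖ ^ 2 ≤ y ⬝ᵥ (A + t • H) *ᵥ y := by
    have h1 := mul_le_mul_of_nonneg_left ((abs_le.mp (hC y)).1) ht.le
    have h2 := hcA y
    have h3 := mul_le_mul_of_nonneg_right htC.le (sq_nonneg ‖y‖)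
    simp only [add_mulVec, smul_mulVec, dotProduct_add, dotProduct_smul, smul_eq_mul]
    linarith
  have hgt (x : Fin m → ℤ) (hx0 : x ≠ 0) (hx : x ∉ minSet A) :
      minOf A < qVal (A + t • H) x := by
    by_cases hx' : c / 2 * ‖fun i => (x i : ℝ)‖ ^ 2 ≤ minOf A
    · rw [qVal_add_smul]
      exact htx x hx' (lt_of_le_of_ne (hμ ▸ hle x hx0) (Ne.symm hx))
    · exact (not_le.mp hx').trans_le (hlow _)
  have heq (x : Fin m → ℤ) (hx : x ∈ minSet A) : qVal (A + t • H) x = minOf A := by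
    rw [qVal_add_smul, hmin x hx, mul_zero, add_zero]
    exact hx
  have hx₀B : qVal (A + t • H) x₀ = minOf A := heq x₀ hμ.symm
  have hminB : minOf (A + t • H) = minOf A := by
    rw [← hx₀B]
    refine minOf_eq_of_forall_le hx₀ fun y hy => ?_
    rw [hx₀B]
    by_cases hyA : y ∈ minSet A
    · exact (heq y hyA).ge
    · exact (hgt y hy hyA).le
  refine ⟨t, ht, .of_dotProduct_mulVec_pos ?_ fun y hy => ?_, hminB, ?_⟩
  · have htH : (t • H).IsHermitian := by
      rw [IsHermitian, conjTranspose_eq_transpose_of_trivial, transpose_smul, hH.eq]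
    exact hA.isHermitian.add htH
  · have : 0 < ‖y‖ := norm_pos_iff.mpr hy
    rw [star_trivial]
    exact lt_of_lt_of_le (by positivity) (hlow y)
  · ext x
    refine ⟨fun hx => ?_, fun hx => (heq x hx).trans hminB.symm⟩
    have hxB : qVal (A + t • H) x = minOf A := Eq.trans hx hminB
    by_contra hxA
    refine (hgt x ?_ hxA).ne' hxB
    rintro rfl
    rw [qVal_zero, hμ] at hxB
    exact (qVal_pos hA hx₀).ne hxB

/-- The rank-one matrix `x xᵀ` of an integer vector. -/
def rankOne {m : ℕ} (x : Fin m → ℤ) : Matrix (Fin m) (Fin m) ℝ :=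
  vecMulVec (fun i => (x i : ℝ)) (fun i => (x i : ℝ))

theorem qVal_eq_trace {m : ℕ} (H : Matrix (Fin m) (Fin m) ℝ) (x : Fin m → ℤ) :
    qVal H x = trace (H * rankOne x) := by
  rw [rankOne, mul_vecMulVec, trace_vecMulVec, dotProduct_comm, qVal]

theorem rankOne_isSymm {m : ℕ} (x : Fin m → ℤ) : (rankOne x).IsSymm := by
  ext i j
  simp [rankOne, vecMulVec_apply, mul_comm]

/-- Every linear functional on matrices is represented on symmetric matrices, up to the factor
`2`, by the trace pairing with a symmetric matrix. -/
theorem exists_isSymm_trace_mul_eq {m : ℕ} (f : Matrix (Fin m) (Fin m) ℝ →ₗ[ℝ] ℝ) :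
    ∃ H : Matrix (Fin m) (Fin m) ℝ, H.IsSymm ∧ ∀ N : Matrix (Fin m) (Fin m) ℝ, N.IsSymm →
      trace (H * N) = 2 * f N := by
  let G : Matrix (Fin m) (Fin m) ℝ := .of fun i j => f (single i j 1)
  have hG (N : Matrix (Fin m) (Fin m) ℝ) : trace (Gᵀ * N) = f N := by
    conv_rhs => rw [matrix_eq_sum_single N]
    simp only [map_sum, trace, diag_apply, mul_apply]
    rw [Finset.sum_comm]
    refine Finset.sum_congr rfl fun i _ => Finset.sum_congr rfl fun j _ => ?_
    have : single i j (N i j) = N i j • single i j (1 : ℝ) := by simp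
    rw [this, map_smul, smul_eq_mul, mul_comm]
    rfl
  refine ⟨G + Gᵀ, isSymm_add_transpose_self G, fun N hN => ?_⟩
  have h : trace (G * N) = trace (Gᵀ * N) := by
    rw [← trace_transpose, transpose_mul, hN.eq, trace_mul_comm]
  rw [add_mul, trace_add, h, hG, two_mul]

theorem span_rankOne_le_symSubmodule {m : ℕ} (s : Set (Fin m → ℤ)) :
    Submodule.span ℝ (rankOne '' s) ≤ symSubmodule m := by
  rw [Submodule.span_le]
  rintro _ ⟨x, -, rfl⟩
  exact rankOne_isSymm x

/-- A positive definite real symmetric matrix is perfect if and only if it is uniquely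
determined by its minimum and its set of minimum points. -/
theorem perfect_iff_uniquely_determined (m : ℕ) (hm : 1 ≤ m)
    (A : Matrix (Fin m) (Fin m) ℝ) (hA : A.PosDef) :
    IsPerfectForm A ↔
      ∀ B : Matrix (Fin m) (Fin m) ℝ, B.PosDef →
        minOf B = minOf A → minSet B = minSet A → B = A := by
  have hdef : IsPerfectForm A ↔ Submodule.span ℝ (rankOne '' minSet A) = symSubmodule m := Iff.rfl
  rw [hdef]
  constructor
  · intro hperf B hB hmin hset
    have hsymm {M : Matrix (Fin m) (Fin m) ℝ} (hM : M.PosDef) : Mᵀ = M := by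
      rw [← conjTranspose_eq_transpose_of_trivial, hM.isHermitian.eq]
    have hker : Submodule.span ℝ (rankOne '' minSet A) ≤
        LinearMap.ker (traceLinearMap (Fin m) ℝ ℝ ∘ₗ LinearMap.mulLeft ℝ (B - A)) := by
      rw [Submodule.span_le]
      rintro _ ⟨x, hx, rfl⟩
      have hxA : qVal A x = minOf A := hx
      have hxB : qVal B x = minOf B := by
        rw [← hset] at hx
        exact hx
      rw [qVal_eq_trace] at hxA hxB
      simp [sub_mul, hxA, hxB, hmin]
    have hBA : (B - A)ᵀ = B - A := by rw [transpose_sub, hsymm hA, hsymm hB]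
    have htr : trace ((B - A) * (B - A)) = 0 := hker (hperf ▸ (hBA : B - A ∈ symSubmodule m))
    rw [← sub_eq_zero, ← trace_conjTranspose_mul_self_eq_zero_iff,
      conjTranspose_eq_transpose_of_trivial, hBA, htr]
  · intro huniq
    refine le_antisymm (span_rankOne_le_symSubmodule _) fun M hM => ?_
    by_contra hMspan
    obtain ⟨f, hfM, hf⟩ := Submodule.exists_le_ker_of_notMem hMspan
    obtain ⟨H, hH, hHf⟩ := exists_isSymm_trace_mul_eq f
    obtain ⟨t, ht, hpos, hmin, hset⟩ := exists_pos_perturbation hm hA hH fun x hx => by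
      have : f (rankOne x) = 0 := hf (Submodule.subset_span ⟨x, hx, rfl⟩)
      rw [qVal_eq_trace, hHf _ (rankOne_isSymm x), this, mul_zero]
    have hH0 : H = 0 := by
      have := huniq _ hpos hmin hset
      simpa [ht.ne'] using this
    have := hHf M hM
    rw [hH0, zero_mul, trace_zero] at this
    exact hfM (by linarith)
end

section
/- Let m ≥ 1. Every perfect positive definite real symmetric m×m matrix A with min(A) = 1 has rational entries, and the set of perfect positive definite real symmetric m×m matrices with minimum 1 decomposes into finitely many orbits under the action of GL_m(ℤ) given by A ↦ PᵀAP. -/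
open Matrix

section QuadraticForms

variable {m : ℕ}

theorem Matrix.PosSemidef.dotProduct_mulVec_le_card_mul_sum_sq {G : Matrix (Fin m) (Fin m) ℝ}
    (hG : G.PosSemidef) (hdiag : ∀ i, G i i = 1) (s : Fin m → ℝ) :
    s ⬝ᵥ (G *ᵥ s) ≤ m * ∑ i, s i ^ 2 := by
  have hpair : ∀ i j, s i * (G i j * s j) ≤ (s i ^ 2 + s j ^ 2) / 2 := by
    intro i j
    have hnonneg := hG.dotProduct_mulVec_nonneg (Pi.single i (s i) - Pi.single j (s j))
    have hsymm : G j i = G i j := by simpa using hG.1.apply i j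
    simp only [star_trivial, mulVec_sub, sub_dotProduct, single_dotProduct, Pi.sub_apply,
      mulVec_single, op_smul_eq_smul, Pi.smul_apply, smul_eq_mul, col_apply, hdiag, hsymm]
      at hnonneg
    nlinarith
  calc s ⬝ᵥ (G *ᵥ s) = ∑ i, ∑ j, s i * (G i j * s j) := by
        simp only [dotProduct, mulVec, Finset.mul_sum]
    _ ≤ ∑ i, ∑ j, (s i ^ 2 + s j ^ 2) / 2 :=
        Finset.sum_le_sum fun i _ => Finset.sum_le_sum fun j _ => hpair i j
    _ = m * ∑ i, s i ^ 2 := by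
        simp only [← Finset.sum_div, Finset.sum_add_distrib, Finset.sum_const, Finset.card_univ,
          Fintype.card_fin, nsmul_eq_mul, ← Finset.mul_sum]
        ring

theorem qVal_transpose_mul_mul (A : Matrix (Fin m) (Fin m) ℝ) (P : Matrix (Fin m) (Fin m) ℤ)
    (x : Fin m → ℤ) :
    qVal ((P.map fun k : ℤ => (k : ℝ))ᵀ * A * (P.map fun k : ℤ => (k : ℝ))) x
      = qVal A (P *ᵥ x) := by
  have hcast : (fun i => ((P *ᵥ x) i : ℝ)) =
      P.map (fun k : ℤ => (k : ℝ)) *ᵥ fun i => (x i : ℝ) := by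
    ext i
    exact RingHom.map_mulVec (Int.castRingHom ℝ) P x i
  rw [qVal, qVal, hcast, ← mulVec_mulVec, ← mulVec_mulVec, dotProduct_mulVec, vecMul_transpose]

theorem one_le_qVal {A : Matrix (Fin m) (Fin m) ℝ} (hA : A.PosDef) (hmin : minOf A = 1)
    {x : Fin m → ℤ} (hx : x ≠ 0) : 1 ≤ qVal A x := by
  rw [← hmin]
  refine csInf_le ⟨0, ?_⟩ ⟨x, hx, rfl⟩
  rintro _ ⟨y, -, rfl⟩
  exact hA.posSemidef.dotProduct_mulVec_nonneg _

/-- A symmetric matrix is determined by its values on the minimal vectors of a perfect form. -/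
theorem IsPerfectForm.eq_of_qVal_eq {A B C : Matrix (Fin m) (Fin m) ℝ} (hA : IsPerfectForm A)
    (hB : B.IsSymm) (hC : C.IsSymm) (h : ∀ x ∈ minSet A, qVal B x = qVal C x) : B = C := by
  have hsymm : (B - C).IsSymm := hB.sub hC
  have hker : ∀ M ∈ symSubmodule m, ((B - C) * M).trace = 0 := by
    intro M hM
    rw [← hA] at hM
    induction hM using Submodule.span_induction with
    | mem _ hx =>
      obtain ⟨x, hx, rfl⟩ := hx
      rw [mul_vecMulVec, trace_vecMulVec, dotProduct_comm, sub_mulVec, dotProduct_sub, sub_eq_zero]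
      exact h x hx
    | zero => simp
    | add _ _ _ _ hx hy => rw [mul_add, trace_add, hx, hy, add_zero]
    | smul c _ _ hx => rw [mul_smul_comm, trace_smul, hx, smul_zero]
  have htrace := hker (B - C) hsymm
  refine sub_eq_zero.mp (trace_conjTranspose_mul_self_eq_zero_iff.mp ?_)
  rwa [conjTranspose_eq_transpose_of_trivial, hsymm.eq]

theorem IsPerfectForm.span_minSet {A : Matrix (Fin m) (Fin m) ℝ} (hA : IsPerfectForm A) :
    Submodule.span ℝ ((fun (x : Fin m → ℤ) (i : Fin m) => (x i : ℝ)) '' minSet A) = ⊤ := by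
  rw [eq_top_iff]
  set S := Submodule.span ℝ ((fun (x : Fin m → ℤ) (i : Fin m) => (x i : ℝ)) '' minSet A)
  have hcol : ∀ M ∈ symSubmodule m, ∀ w, M *ᵥ w ∈ S := by
    intro M hM w
    rw [← hA] at hM
    induction hM using Submodule.span_induction with
    | mem _ hx =>
      obtain ⟨x, hx, rfl⟩ := hx
      rw [vecMulVec_mulVec, op_smul_eq_smul]
      exact S.smul_mem _ (Submodule.subset_span ⟨x, hx, rfl⟩)
    | zero => simp
    | add _ _ _ _ hx hy => rw [add_mulVec]; exact S.add_mem hx hy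
    | smul c _ _ hx => rw [smul_mulVec]; exact S.smul_mem _ hx
  intro w _
  simpa using hcol 1 isSymm_one w

theorem IsPerfectForm.exists_det_ne_zero {A : Matrix (Fin m) (Fin m) ℝ} (hA : IsPerfectForm A) :
    ∃ V : Matrix (Fin m) (Fin m) ℤ, (∀ j, V.col j ∈ minSet A) ∧ V.det ≠ 0 := by
  obtain ⟨b, hbsub, hbspan, hbli⟩ := exists_linearIndependent ℝ
    ((fun (x : Fin m → ℤ) (i : Fin m) => (x i : ℝ)) '' minSet A)
  rw [hA.span_minSet] at hbspan
  let basis := Module.Basis.mk hbli (by rw [Subtype.range_coe, hbspan])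
  have : Fintype b := FiniteDimensional.fintypeBasisIndex basis
  have hcard : Fintype.card (Fin m) = Fintype.card b := by
    rw [← Module.finrank_eq_card_basis basis, Module.finrank_pi]
  let e := Fintype.equivOfCardEq hcard
  choose v hv hvb using fun j => hbsub (e j).2
  refine ⟨(Matrix.of v)ᵀ, hv, ?_⟩
  have hunit : IsUnit ((Matrix.of v)ᵀ.map (Int.castRingHom ℝ)) := by
    rw [← linearIndependent_cols_iff_isUnit]
    convert! hbli.comp e e.injective using 1
    ext j : 1
    exact hvb j
  rw [isUnit_iff_isUnit_det, ← RingHom.mapMatrix_apply, ← RingHom.map_det, isUnit_iff_ne_zero]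
    at hunit
  exact fun h => hunit (by rw [h, map_zero])

/-- Minkowski's theorem for the parallelepiped of vectors whose coordinates with respect to the
columns of `V` are less than `r` in absolute value. -/
theorem exists_ne_zero_mulVec_eq_intCast (V : Matrix (Fin m) (Fin m) ℤ) {r : ℝ} (hr : 0 < r)
    (hV : 1 < |(V.det : ℝ)| * r ^ m) :
    ∃ (y : Fin m → ℤ) (s : Fin m → ℝ), y ≠ 0 ∧ (∀ i, |s i| < r) ∧
      V.map (fun k : ℤ => (k : ℝ)) *ᵥ s = fun i => (y i : ℝ) := by
  set W : Matrix (Fin m) (Fin m) ℝ := V.map (fun k : ℤ => (k : ℝ))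
  have hdet : W.det = V.det := (RingHom.map_det (Int.castRingHom ℝ) V).symm
  let L := (Submodule.span ℤ (Set.range (Pi.basisFun ℝ (Fin m)))).toAddSubgroup
  have hcount : Countable L :=
    inferInstanceAs (Countable (Submodule.span ℤ (Set.range (Pi.basisFun ℝ (Fin m)))))
  have hvol : MeasureTheory.volume (ZSpan.fundamentalDomain (Pi.basisFun ℝ (Fin m))) *
      2 ^ Module.finrank ℝ (Fin m → ℝ) <
      MeasureTheory.volume (W.toLin' '' Metric.ball 0 r) := by
    rw [MeasureTheory.Measure.addHaar_image_linearMap, Real.volume_pi_ball _ hr,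
      ZSpan.fundamentalDomain_pi_basisFun, MeasureTheory.volume_pi_pi, LinearMap.det_toLin', hdet,
      ← ENNReal.ofReal_mul (abs_nonneg _)]
    simp only [Real.volume_Ico, sub_zero, ENNReal.ofReal_one, Finset.prod_const_one, one_mul,
      Module.finrank_pi, Fintype.card_fin]
    rw [← ENNReal.ofReal_ofNat, ← ENNReal.ofReal_pow (by norm_num)]
    have hpos : (0 : ℝ) < 2 ^ m := by positivity
    refine (ENNReal.ofReal_lt_ofReal_iff_of_nonneg hpos.le).mpr ?_
    rw [mul_pow]
    nlinarith
  obtain ⟨⟨z, hzL⟩, hz0, s, hs, hsz⟩ :=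
    MeasureTheory.exists_ne_zero_mem_lattice_of_measure_mul_two_pow_lt_measure
      (ZSpan.isAddFundamentalDomain' (Pi.basisFun ℝ (Fin m)) MeasureTheory.volume)
      (s := W.toLin' '' Metric.ball 0 r)
      (by
        rintro _ ⟨s, hs, rfl⟩
        exact ⟨-s, by simpa using hs, map_neg _ _⟩)
      ((convex_ball 0 r).linear_image _) hvol
  choose y hy using (Module.Basis.mem_span_iff_repr_mem ℤ (Pi.basisFun ℝ (Fin m)) z).mp hzL
  have hyz : (fun i => (y i : ℝ)) = z := funext fun i => by simpa using hy i
  refine ⟨y, s, ?_, fun i => ?_, ?_⟩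
  · rintro rfl
    exact hz0 (Subtype.ext (hyz.symm.trans (by ext; simp)))
  · rw [← Real.norm_eq_abs]
    exact (norm_le_pi_norm s i).trans_lt (by simpa using hs)
  · rw [hyz]
    exact hsz

theorem natAbs_det_le_of_mem_minSet (hm : 1 ≤ m) {A : Matrix (Fin m) (Fin m) ℝ} (hA : A.PosDef)
    (hmin : minOf A = 1) {V : Matrix (Fin m) (Fin m) ℤ} (hV : ∀ j, V.col j ∈ minSet A) :
    V.det.natAbs ≤ m ^ m := by
  by_contra! hlarge
  have hmpos : (0 : ℝ) < m := by exact_mod_cast hm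
  have hdet : 1 < |(V.det : ℝ)| * (1 / (m : ℝ)) ^ m := by
    rw [one_div, inv_pow, ← div_eq_mul_inv, one_lt_div (by positivity), ← Int.cast_abs,
      Int.abs_eq_natAbs]
    exact_mod_cast hlarge
  obtain ⟨y, s, hy, hs, hVs⟩ := exists_ne_zero_mulVec_eq_intCast V (by positivity) hdet
  set W : Matrix (Fin m) (Fin m) ℝ := V.map (fun k : ℤ => (k : ℝ))
  have hG : (Wᵀ * A * W).PosSemidef := hA.posSemidef.conjTranspose_mul_mul_same W
  have hdiag : ∀ i, (Wᵀ * A * W) i i = 1 := by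
    intro i
    have hcol : qVal A (V.col i) = 1 := (hV i).trans hmin
    have hcast : (fun k => ((Pi.single i 1 : Fin m → ℤ) k : ℝ)) = Pi.single i 1 := by
      ext k
      simp [Pi.single_apply]
    rw [← mulVec_single_one, ← qVal_transpose_mul_mul, qVal, hcast, mulVec_single_one,
      single_one_dotProduct, col_apply] at hcol
    exact hcol
  have hbound := hG.dotProduct_mulVec_le_card_mul_sum_sq hdiag s
  have hone := one_le_qVal hA hmin hy
  rw [qVal, ← hVs] at hone
  have hval : s ⬝ᵥ ((Wᵀ * A * W) *ᵥ s) = (W *ᵥ s) ⬝ᵥ (A *ᵥ (W *ᵥ s)) := by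
    rw [← mulVec_mulVec, ← mulVec_mulVec, dotProduct_mulVec, vecMul_transpose]
  have hsum : ∑ i, s i ^ 2 < ∑ _i : Fin m, (1 / (m : ℝ)) ^ 2 := by
    refine Finset.sum_lt_sum_of_nonempty ⟨⟨0, hm⟩, Finset.mem_univ _⟩ fun i _ => ?_
    exact sq_lt_sq' (abs_lt.mp (hs i)).1 (abs_lt.mp (hs i)).2
  have hcalc : (m : ℝ) * ∑ _i : Fin m, (1 / (m : ℝ)) ^ 2 = 1 := by
    simp only [Finset.sum_const, Finset.card_univ, Fintype.card_fin, nsmul_eq_mul]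
    field_simp
  have hlt := mul_lt_mul_of_pos_left hsum hmpos
  linarith

/-- The columns of `V` are independent minimal vectors of `A` spanning a sublattice of maximal
index, so that all minimal vectors of `A` have coordinates at most one in absolute value. -/
structure IsMaximalFrame (A : Matrix (Fin m) (Fin m) ℝ) (V : Matrix (Fin m) (Fin m) ℤ) : Prop where
  det_ne_zero : V.det ≠ 0
  natAbs_det_le : V.det.natAbs ≤ m ^ m
  natAbs_adjugate_mulVec_le : ∀ x ∈ minSet A, ∀ i, ((V.adjugate *ᵥ x) i).natAbs ≤ V.det.natAbs

theorem IsPerfectForm.exists_isMaximalFrame (hm : 1 ≤ m) {A : Matrix (Fin m) (Fin m) ℝ}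
    (hA : A.PosDef) (hperf : IsPerfectForm A) (hmin : minOf A = 1) :
    ∃ V, IsMaximalFrame A V := by
  let T : Set ℕ := {n | ∃ V : Matrix (Fin m) (Fin m) ℤ,
    (∀ j, V.col j ∈ minSet A) ∧ V.det.natAbs = n}
  obtain ⟨V₀, hV₀, hdet₀⟩ := hperf.exists_det_ne_zero
  have hne : T.Nonempty := ⟨_, V₀, hV₀, rfl⟩
  have hbdd : BddAbove T := by
    refine ⟨m ^ m, ?_⟩
    rintro _ ⟨V, hV, rfl⟩
    exact natAbs_det_le_of_mem_minSet hm hA hmin hV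
  obtain ⟨V, hV, hVsup⟩ := Nat.sSup_mem hne hbdd
  refine ⟨V, ⟨?_, natAbs_det_le_of_mem_minSet hm hA hmin hV, fun x hx i => ?_⟩⟩
  · have hle := le_csSup hbdd ⟨V₀, hV₀, rfl⟩
    have hpos := Int.natAbs_pos.mpr hdet₀
    omega
  · rw [← cramer_eq_adjugate_mulVec, cramer_apply, hVsup]
    refine le_csSup hbdd ⟨_, fun j => ?_, rfl⟩
    by_cases hji : j = i
    · subst hji
      have hcol : (V.updateCol j x).col j = x := by ext; simp
      rwa [hcol]
    · have hcol : (V.updateCol i x).col j = V.col j := by ext; simp [hji]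
      rw [hcol]
      exact hV j

/-- The index of the frame `V`, its adjugate modulo this index, and the scaled coordinates of the
minimal vectors of `A`. -/
def frameInvariant (A : Matrix (Fin m) (Fin m) ℝ) (V : Matrix (Fin m) (Fin m) ℤ) :
    ℤ × (Fin m → Fin m → ℤ) × Set (Fin m → ℤ) :=
  (V.det, fun i j => V.adjugate i j % V.det, (fun x => V.adjugate *ᵥ x) '' minSet A)

theorem finite_setOf_frameInvariant (m : ℕ) :
    {d | ∃ (A : Matrix (Fin m) (Fin m) ℝ) (V : Matrix (Fin m) (Fin m) ℤ),
      IsMaximalFrame A V ∧ d = frameInvariant A V}.Finite := by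
  let I : Set ℤ := Set.Icc (-(m ^ m : ℕ)) (m ^ m : ℕ)
  have hI : I.Finite := Set.finite_Icc _ _
  have hvec : (Set.univ.pi fun _ : Fin m => I).Finite := Set.Finite.pi fun _ => hI
  refine (hI.prod ((Set.Finite.pi' fun _ : Fin m => Set.Finite.pi' fun _ : Fin m => hI).prod
    hvec.finite_subsets)).subset ?_
  rintro _ ⟨A, V, hV, rfl⟩
  have hdet := hV.natAbs_det_le
  refine ⟨?_, fun i j => ?_, ?_⟩
  · simp only [frameInvariant, I, Set.mem_Icc]
    omega
  · have hnonneg := Int.emod_nonneg (V.adjugate i j) hV.det_ne_zero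
    have hlt := Int.emod_lt (V.adjugate i j) hV.det_ne_zero
    simp only [frameInvariant, I, Set.mem_Icc]
    omega
  · rintro _ ⟨x, hx, rfl⟩ i -
    have hle := hV.natAbs_adjugate_mulVec_le x hx i
    simp only [I, Set.mem_Icc]
    omega

theorem exists_unimodular_of_frameInvariant_eq {A B : Matrix (Fin m) (Fin m) ℝ}
    {V W : Matrix (Fin m) (Fin m) ℤ} (hV : V.det ≠ 0) (hAsymm : A.IsSymm) (hBsymm : B.IsSymm)
    (hA : IsPerfectForm A) (hmin : minOf A = minOf B)
    (h : frameInvariant A V = frameInvariant B W) :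
    ∃ P : Matrix (Fin m) (Fin m) ℤ, IsUnit P.det ∧
      A = (P.map fun k : ℤ => (k : ℝ))ᵀ * B * (P.map fun k : ℤ => (k : ℝ)) := by
  simp only [frameInvariant, Prod.mk.injEq] at h
  obtain ⟨hdet, hadj, himage⟩ := h
  have hdvd : ∀ i j, V.det ∣ V.adjugate i j - W.adjugate i j := by
    intro i j
    have hij := congrFun₂ hadj i j
    rw [← hdet] at hij
    exact Int.ModEq.dvd hij.symm
  choose k hk using hdvd
  let K : Matrix (Fin m) (Fin m) ℤ := Matrix.of k
  have hK : V.adjugate = W.adjugate + V.det • K := by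
    ext i j
    have := hk i j
    simp only [Matrix.add_apply, Matrix.smul_apply, smul_eq_mul, K, Matrix.of_apply]
    linarith
  let P : Matrix (Fin m) (Fin m) ℤ := 1 + W * K
  have hWadj : W * V.adjugate = V.det • P := by
    rw [hK, mul_add, mul_adjugate, ← hdet, mul_smul_comm, smul_add]
  have hPV : P * V = W := by
    have hsmul : V.det • (P * V) = V.det • W := by
      rw [← smul_mul_assoc, ← hWadj, mul_assoc, adjugate_mul, mul_smul_comm, mul_one]
    exact smul_right_injective _ hV hsmul
  have hPdet : P.det = 1 := by
    have hprod := congrArg Matrix.det hPV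
    rw [det_mul, ← hdet] at hprod
    exact mul_right_cancel₀ hV (by rw [hprod, one_mul])
  refine ⟨P, hPdet ▸ isUnit_one, hA.eq_of_qVal_eq hAsymm ?_ fun x hx => ?_⟩
  · rw [IsSymm, transpose_mul, transpose_mul, transpose_transpose, hBsymm.eq, mul_assoc]
  · obtain ⟨y, hy, hyx⟩ : V.adjugate *ᵥ x ∈ (fun x => W.adjugate *ᵥ x) '' minSet B :=
      himage ▸ ⟨x, hx, rfl⟩
    have hPx : P *ᵥ x = y := by
      refine smul_right_injective _ hV ?_
      change V.det • (P *ᵥ x) = V.det • y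
      rw [← smul_mulVec, ← hWadj, ← mulVec_mulVec, ← hyx, mulVec_mulVec, mul_adjugate, ← hdet,
        smul_mulVec, one_mulVec]
    rw [qVal_transpose_mul_mul, hPx]
    exact (hx.trans hmin).trans hy.symm

theorem IsPerfectForm.exists_rat {A : Matrix (Fin m) (Fin m) ℝ} (hA : IsPerfectForm A)
    (hsymm : A.IsSymm) (hmin : minOf A = 1) (i j : Fin m) : ∃ q : ℚ, A i j = q := by
  obtain ⟨f, hf⟩ := (Algebra.linearMap ℚ ℝ).exists_leftInverse_of_injective
    (LinearMap.ker_eq_bot.mpr (algebraMap ℚ ℝ).injective)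
  have hf1 : f 1 = 1 := by simpa using LinearMap.congr_fun hf 1
  have hfval : ∀ x : Fin m → ℤ, qVal (A.map fun a => ((f a : ℚ) : ℝ)) x = (f (qVal A x) : ℚ) := by
    intro x
    have hterm : ∀ i j, f (x i * (A i j * x j)) = x i * (f (A i j) * x j) := by
      intro i j
      have : (x i : ℝ) * (A i j * x j) = (x i * x j : ℤ) • A i j := by
        rw [zsmul_eq_mul]; push_cast; ring
      rw [this, map_zsmul, zsmul_eq_mul]
      push_cast
      ring
    simp only [qVal, dotProduct, mulVec, Finset.mul_sum, map_sum, hterm, map_apply]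
    push_cast
    rfl
  have heq := hA.eq_of_qVal_eq (B := A) (C := A.map fun a => ((f a : ℚ) : ℝ)) hsymm
    (hsymm.map _) fun x hx => by
      have hx1 : qVal A x = 1 := hx.trans hmin
      rw [hfval, hx1, hf1, Rat.cast_one]
  exact ⟨f (A i j), congrFun₂ heq i j⟩

end QuadraticForms

/-- Every perfect positive definite real symmetric matrix with minimum 1 has rational
entries, and there are only finitely many `GL_m(ℤ)`-orbits (under `A ↦ Pᵀ A P`) of
perfect positive definite matrices with minimum 1. -/
theorem perfect_forms_rational_and_finitely_many_orbits (m : ℕ) (hm : 1 ≤ m) :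
    (∀ A : Matrix (Fin m) (Fin m) ℝ, A.PosDef → IsPerfectForm A → minOf A = 1 →
      ∀ i j, ∃ q : ℚ, A i j = (q : ℝ)) ∧
    ∃ s : Set (Matrix (Fin m) (Fin m) ℝ), s.Finite ∧
      s ⊆ {A | A.PosDef ∧ IsPerfectForm A ∧ minOf A = 1} ∧
      ∀ A : Matrix (Fin m) (Fin m) ℝ, A.PosDef → IsPerfectForm A → minOf A = 1 →
        ∃ B ∈ s, ∃ P : Matrix (Fin m) (Fin m) ℤ, IsUnit P.det ∧
          A = (P.map (fun k : ℤ => (k : ℝ)))ᵀ * B * (P.map (fun k : ℤ => (k : ℝ))) := by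
  have hsymm : ∀ A : Matrix (Fin m) (Fin m) ℝ, A.PosDef → A.IsSymm := fun A hA => by
    simpa [IsHermitian, IsSymm] using hA.1
  refine ⟨fun A hA hperf hmin => hperf.exists_rat (hsymm A hA) hmin, ?_⟩
  have hframe : ∀ A : Matrix (Fin m) (Fin m) ℝ, ∃ V,
      A.PosDef ∧ IsPerfectForm A ∧ minOf A = 1 → IsMaximalFrame A V := by
    intro A
    by_cases hA : A.PosDef ∧ IsPerfectForm A ∧ minOf A = 1
    · obtain ⟨V, hV⟩ := hA.2.1.exists_isMaximalFrame hm hA.1 hA.2.2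
      exact ⟨V, fun _ => hV⟩
    · exact ⟨0, fun h => absurd h hA⟩
  choose V hV using hframe
  obtain ⟨s, hs, hbij⟩ := Set.exists_subset_bijOn
    {A : Matrix (Fin m) (Fin m) ℝ | A.PosDef ∧ IsPerfectForm A ∧ minOf A = 1}
    fun A => frameInvariant A (V A)
  refine ⟨s, ?_, hs, fun A hA hperf hmin => ?_⟩
  · refine hbij.finite_iff_finite.mpr ((finite_setOf_frameInvariant m).subset ?_)
    rintro _ ⟨A, hA, rfl⟩
    exact ⟨A, V A, hV A hA, rfl⟩
  · obtain ⟨B, hBs, hBA⟩ := hbij.surjOn ⟨A, ⟨hA, hperf, hmin⟩, rfl⟩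
    obtain ⟨hB, -, hBmin⟩ := hs hBs
    exact ⟨B, hBs, exists_unimodular_of_frameInvariant_eq (hV A ⟨hA, hperf, hmin⟩).det_ne_zero
      (hsymm A hA) (hsymm B hB) hperf (hmin.trans hBmin.symm) hBA.symm⟩
end

section
/- Every finite subgroup of PGL₂(ℂ) is isomorphic to one of the following groups: a cyclic group ℤ/r (r ≥ 1), a dihedral group D_r of order 2r (r ≥ 2), the alternating group A₄, the symmetric group S₄, or the alternating group A₅. -/
open scoped MatrixGroups

/-- `PGL₂(K)`: the quotient of `GL₂(K)` by its center (the nonzero scalar matrices). -/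
abbrev PGL2 (K : Type*) [Field K] :=
  GL (Fin 2) K ⧸ Subgroup.center (GL (Fin 2) K)

open MulAction Subgroup

section DoubleCounting

variable {G S : Type*} [Group G] [MulAction G S]

theorem card_orbit_mul_card_stabilizer (x : S) :
    Nat.card (orbit G x) * Nat.card (stabilizer G x) = Nat.card G := by
  rw [← Nat.card_prod]
  exact Nat.card_congr (orbitProdStabilizerEquivGroup G x)

theorem card_stabilizer_eq_of_mem_orbit {x y : S} (h : y ∈ orbit G x) :
    Nat.card (stabilizer G y) = Nat.card (stabilizer G x) := by
  obtain ⟨g, rfl⟩ := h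
  exact Nat.card_congr (stabilizerEquivStabilizer (rfl : g • x = g • x)).symm.toEquiv

theorem exists_smul_eq_self (h2 : ∀ g : G, g ≠ 1 → Nat.card (fixedBy S g) = 2) {g : G}
    (hg : g ≠ 1) : ∃ x : S, g • x = x := by
  have : Nat.card (fixedBy S g) ≠ 0 := by rw [h2 g hg]; decide
  obtain ⟨⟨x, hx⟩⟩ := (Nat.card_ne_zero.mp this).1
  exact ⟨x, hx⟩

variable [Finite S]

theorem card_eq_sum_card_orbit :
    Nat.card S = ∑ᶠ ω : orbitRel.Quotient G S, Nat.card (orbit G ω.out) := by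
  classical
  have := Fintype.ofFinite (orbitRel.Quotient G S)
  rw [finsum_eq_sum_of_fintype, ← Nat.card_sigma]
  exact Nat.card_congr (selfEquivSigmaOrbits G S)

variable [Finite G]

theorem card_orbit_mul_card_inf_stabilizer_sub_one_le
    (h2 : ∀ g : G, g ≠ 1 → Nat.card (fixedBy S g) = 2) (K : Subgroup G) [K.Normal] (x : S) :
    Nat.card (orbit G x) * (Nat.card (K ⊓ stabilizer G x : Subgroup G) - 1) ≤
      (Nat.card K - 1) * 2 := by
  classical
  have := Fintype.ofFinite G
  have := Fintype.ofFinite S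
  have hs : Nat.card (orbit G x) = (orbit G x).toFinset.card := by simp [Nat.card_eq_fintype_card]
  have ht : Nat.card K - 1 = ((K : Set G).toFinset.erase 1).card := by
    rw [Finset.card_erase_of_mem (by simp), Set.toFinset_card, ← Nat.card_eq_fintype_card]
    rfl
  rw [hs, ht]
  refine Finset.card_mul_le_card_mul (fun (y : S) (k : G) => k • y = y) ?_ ?_
  · intro y hy
    obtain ⟨g, rfl⟩ : y ∈ orbit G x := by simpa using hy
    have : Nat.card (K ⊓ stabilizer G x : Subgroup G) - 1 =
        (((K ⊓ stabilizer G x : Subgroup G) : Set G).toFinset.erase 1).card := by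
      rw [Finset.card_erase_of_mem (by simp), Set.toFinset_card, ← Nat.card_eq_fintype_card]
      rfl
    rw [this]
    refine Finset.card_le_card_of_injOn (fun k => g * k * g⁻¹) ?_ ?_
    · intro k hk
      simp only [Finset.coe_erase, Set.coe_toFinset, Set.mem_sdiff, SetLike.mem_coe,
        Subgroup.mem_inf, mem_stabilizer_iff, Set.mem_singleton_iff] at hk
      obtain ⟨⟨hk, hx⟩, h1⟩ := hk
      simp [Finset.bipartiteAbove, mul_smul, hx, h1, Normal.conj_mem (inferInstance : K.Normal) k hk g]
    · intro a _ b _ h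
      simpa using h
  · intro k hk
    simp only [Finset.mem_erase] at hk
    rw [← h2 k hk.1, Nat.card_eq_fintype_card, ← Set.toFinset_card]
    refine Finset.card_le_card fun y hy => ?_
    simpa using (Finset.mem_filter.mp hy).2

theorem exists_card_le_of_normal (h2 : ∀ g : G, g ≠ 1 → Nat.card (fixedBy S g) = 2)
    (K : Subgroup G) [K.Normal] (hK : K ≠ ⊥) :
    ∃ x : S, Nat.card G ≤ Nat.card (stabilizer G x) * ((Nat.card K - 1) * 2) := by
  obtain ⟨k, hk, h1⟩ := K.bot_or_exists_ne_one.resolve_left hK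
  obtain ⟨x, hx⟩ := exists_smul_eq_self h2 h1
  refine ⟨x, ?_⟩
  have h := card_orbit_mul_card_inf_stabilizer_sub_one_le h2 K x
  have : 1 < Nat.card (K ⊓ stabilizer G x : Subgroup G) := by
    rw [one_lt_card_iff_ne_bot]
    intro h
    exact h1 ((Subgroup.eq_bot_iff_forall _).mp h k ⟨hk, hx⟩)
  rw [← card_orbit_mul_card_stabilizer x, mul_comm]
  gcongr
  refine le_trans ?_ h
  exact Nat.le_mul_of_pos_right _ (by omega)

theorem card_mul_le_of_normal_of_prime_dvd
    (h2 : ∀ g : G, g ≠ 1 → Nat.card (fixedBy S g) = 2) (K : Subgroup G) [K.Normal] {q : ℕ}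
    (hq : q.Prime)
    (hr : ∀ x : S, q ∣ Nat.card (stabilizer G x) → Nat.card (stabilizer G x) = q)
    (hK : q ∣ Nat.card K) :
    Nat.card G * (q - 1) ≤ q * ((Nat.card K - 1) * 2) := by
  have := Fact.mk hq
  obtain ⟨⟨k, hk⟩, hkq⟩ := exists_prime_orderOf_dvd_card' q hK
  rw [Subgroup.orderOf_mk] at hkq
  have h1 : k ≠ 1 := by
    rintro rfl
    exact hq.one_lt.ne (by simpa using hkq)
  obtain ⟨x, hx⟩ := exists_smul_eq_self h2 h1
  have hle : zpowers k ≤ K ⊓ stabilizer G x := by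
    rw [zpowers_le]; exact ⟨hk, hx⟩
  have hd : q ∣ Nat.card (K ⊓ stabilizer G x : Subgroup G) := by
    rw [← hkq, ← Nat.card_zpowers]
    exact card_dvd_of_le hle
  have hxq := hr x (hd.trans (card_dvd_of_le inf_le_right))
  have h := card_orbit_mul_card_inf_stabilizer_sub_one_le h2 K x
  have hqle := Nat.le_of_dvd Nat.card_pos hd
  rw [← card_orbit_mul_card_stabilizer x, hxq, mul_comm _ q, mul_assoc]
  refine Nat.mul_le_mul_left q (le_trans ?_ h)
  gcongr

theorem card_centralizer_le (h2 : ∀ g : G, g ≠ 1 → Nat.card (fixedBy S g) = 2) {g : G}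
    (hg : g ≠ 1) {x : S} (hx : g • x = x) :
    Nat.card (centralizer {g}) ≤ 2 * Nat.card (stabilizer G x) := by
  rw [← card_orbit_mul_card_stabilizer (G := centralizer {g}) x]
  refine Nat.mul_le_mul ?_ ?_
  · rw [← h2 g hg]
    refine Nat.card_mono (Set.toFinite _) ?_
    rintro _ ⟨⟨c, hc⟩, rfl⟩
    rw [mem_centralizer_singleton_iff] at hc
    change g • c • x = c • x
    rw [← mul_smul, ← hc, mul_smul, hx]
  · refine Nat.card_le_card_of_injective
      (fun c : stabilizer (centralizer {g}) x => (⟨c.1.1, c.2⟩ : stabilizer G x)) ?_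
    intro a b h
    have h' : a.1.1 = b.1.1 := Subtype.mk.inj h
    exact Subtype.ext (Subtype.ext h')

theorem card_add_eq_card_orbits_mul (h2 : ∀ g : G, g ≠ 1 → Nat.card (fixedBy S g) = 2) :
    Nat.card S + (Nat.card G - 1) * 2 = Nat.card (orbitRel.Quotient G S) * Nat.card G := by
  classical
  have := Fintype.ofFinite G
  have := Fintype.ofFinite S
  have := Fintype.ofFinite (orbitRel.Quotient G S)
  have h := sum_card_fixedBy_eq_card_orbits_mul_card_group G S
  rw [← Finset.add_sum_erase _ _ (Finset.mem_univ (1 : G)),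
    Finset.sum_congr rfl (g := fun _ => 2)] at h
  · rw [Finset.sum_const, Finset.card_erase_of_mem (Finset.mem_univ _), smul_eq_mul] at h
    simp only [Nat.card_eq_fintype_card]
    rw [Finset.card_univ] at h
    convert h using 2
    exact Fintype.card_congr ⟨fun x => ⟨x, by simp⟩, fun x => x.1, fun _ => rfl, fun _ => rfl⟩
  · intro g hg
    rw [← Nat.card_eq_fintype_card]
    exact h2 g (Finset.ne_of_mem_erase hg)

end DoubleCounting

section OrbitTypes

variable {G S : Type*} [Group G] [Finite G] [MulAction G S] [Finite S]

theorem card_orbits_lt_four (h2 : ∀ g : G, g ≠ 1 → Nat.card (fixedBy S g) = 2)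
    (hst : ∀ x : S, 2 ≤ Nat.card (stabilizer G x)) :
    Nat.card (orbitRel.Quotient G S) < 4 := by
  have := Fintype.ofFinite (orbitRel.Quotient G S)
  have hN : 0 < Nat.card G := Nat.card_pos
  have h1 := card_add_eq_card_orbits_mul h2
  have h3 : 2 * Nat.card S ≤ Nat.card (orbitRel.Quotient G S) * Nat.card G := by
    rw [card_eq_sum_card_orbit (G := G) (S := S), finsum_eq_sum_of_fintype, Finset.mul_sum,
      Nat.card_eq_fintype_card (α := orbitRel.Quotient G S), ← Finset.card_univ, ← smul_eq_mul,
      ← Finset.sum_const]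
    refine Finset.sum_le_sum fun ω _ => ?_
    rw [← card_orbit_mul_card_stabilizer (G := G) ω.out, mul_comm]
    exact Nat.mul_le_mul_left _ (hst _)
  by_contra! h
  obtain ⟨N, hN'⟩ : ∃ N, Nat.card G = N + 1 := ⟨Nat.card G - 1, by omega⟩
  rw [hN'] at h1 h3
  simp only [add_tsub_cancel_right] at h1
  nlinarith

theorem exists_orbit_representatives (h2 : ∀ g : G, g ≠ 1 → Nat.card (fixedBy S g) = 2)
    (h3 : Nat.card (orbitRel.Quotient G S) = 3) :
    ∃ x₁ x₂ x₃ : S, (∀ y : S, y ∈ orbit G x₁ ∨ y ∈ orbit G x₂ ∨ y ∈ orbit G x₃) ∧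
      Nat.card (orbit G x₁) + Nat.card (orbit G x₂) + Nat.card (orbit G x₃) = Nat.card G + 2 := by
  have := Fintype.ofFinite (orbitRel.Quotient G S)
  have hN : 0 < Nat.card G := Nat.card_pos
  have h1 := card_add_eq_card_orbits_mul h2
  let e := Finite.equivFinOfCardEq h3
  refine ⟨(e.symm 0).out, (e.symm 1).out, (e.symm 2).out, ?_, ?_⟩
  · intro y
    obtain ⟨i, hi⟩ := e.symm.surjective (Quotient.mk'' y)
    have hy : y ∈ orbit G (e.symm i).out := by
      rw [hi, ← orbitRel_apply]
      exact Quotient.exact (Quotient.out_eq' (Quotient.mk'' y : orbitRel.Quotient G S)).symm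
    fin_cases i
    · exact Or.inl hy
    · exact Or.inr (Or.inl hy)
    · exact Or.inr (Or.inr hy)
  · have h4 := card_eq_sum_card_orbit (G := G) (S := S)
    rw [finsum_eq_sum_of_fintype, ← Equiv.sum_comp e.symm, Fin.sum_univ_three] at h4
    rw [h3] at h1
    omega

theorem exists_orbit_representatives_le (h2 : ∀ g : G, g ≠ 1 → Nat.card (fixedBy S g) = 2)
    (h3 : Nat.card (orbitRel.Quotient G S) = 3) :
    ∃ x₁ x₂ x₃ : S, (∀ y : S, y ∈ orbit G x₁ ∨ y ∈ orbit G x₂ ∨ y ∈ orbit G x₃) ∧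
      Nat.card (orbit G x₁) + Nat.card (orbit G x₂) + Nat.card (orbit G x₃) = Nat.card G + 2 ∧
      Nat.card (stabilizer G x₁) ≤ Nat.card (stabilizer G x₂) ∧
      Nat.card (stabilizer G x₂) ≤ Nat.card (stabilizer G x₃) := by
  obtain ⟨x, y, z, h, hs⟩ := exists_orbit_representatives h2 h3
  rcases le_total (Nat.card (stabilizer G x)) (Nat.card (stabilizer G y)) with hxy | hxy <;>
  rcases le_total (Nat.card (stabilizer G y)) (Nat.card (stabilizer G z)) with hyz | hyz <;>
  rcases le_total (Nat.card (stabilizer G x)) (Nat.card (stabilizer G z)) with hxz | hxz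
  · exact ⟨x, y, z, h, hs, hxy, hyz⟩
  · exact ⟨x, y, z, h, hs, hxy, hyz⟩
  · exact ⟨x, z, y, fun w => by have := h w; tauto, by omega, hxz, hyz⟩
  · exact ⟨z, x, y, fun w => by have := h w; tauto, by omega, hxz, hxy⟩
  · exact ⟨y, x, z, fun w => by have := h w; tauto, by omega, hxy, hxz⟩
  · exact ⟨y, z, x, fun w => by have := h w; tauto, by omega, hyz, hxz⟩
  · exact ⟨z, y, x, fun w => by have := h w; tauto, by omega, hyz, hxy⟩
  · exact ⟨z, y, x, fun w => by have := h w; tauto, by omega, hyz, hxy⟩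

theorem orbit_type_arithmetic {N r₁ r₂ r₃ s₁ s₂ s₃ : ℕ} (h₁ : s₁ * r₁ = N)
    (h₂ : s₂ * r₂ = N) (h₃ : s₃ * r₃ = N) (hs : s₁ + s₂ + s₃ = N + 2) (hr : 2 ≤ r₁)
    (h₁₂ : r₁ ≤ r₂) (h₂₃ : r₂ ≤ r₃) :
    r₁ = 2 ∧ (r₂ = 2 ∧ N = 2 * r₃ ∨
      r₂ = 3 ∧ (r₃ = 3 ∧ N = 12 ∨ r₃ = 4 ∧ N = 24 ∨ r₃ = 5 ∧ N = 60)) := by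
  obtain rfl : r₁ = 2 := by
    by_contra h
    have a₁ : s₁ * 3 ≤ N := h₁ ▸ Nat.mul_le_mul_left s₁ (by omega)
    have a₂ : s₂ * 3 ≤ N := h₂ ▸ Nat.mul_le_mul_left s₂ (by omega)
    have a₃ : s₃ * 3 ≤ N := h₃ ▸ Nat.mul_le_mul_left s₃ (by omega)
    omega
  refine ⟨rfl, ?_⟩
  have hr₂ : r₂ < 4 := by
    by_contra h
    have a₂ : s₂ * 4 ≤ N := h₂ ▸ Nat.mul_le_mul_left s₂ (by omega)
    have a₃ : s₃ * 4 ≤ N := h₃ ▸ Nat.mul_le_mul_left s₃ (by omega)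
    omega
  obtain rfl | rfl : r₂ = 2 ∨ r₂ = 3 := by omega
  · left
    obtain rfl : s₃ = 2 := by omega
    exact ⟨rfl, h₃.symm⟩
  · right
    have hr₃ : r₃ < 6 := by
      by_contra h
      have a₃ : s₃ * 6 ≤ N := h₃ ▸ Nat.mul_le_mul_left s₃ (by omega)
      omega
    interval_cases r₃ <;> omega

end OrbitTypes

section Recognition

theorem nonempty_mulEquiv_dihedralGroup {G : Type*} [Group G] {n : ℕ} (hn : 2 ≤ n)
    (hG : Nat.card G = 2 * n) (C : Subgroup G) [IsCyclic C] (hC : Nat.card C = n)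
    (h : ∀ g ∉ C, g * g = 1) : Nonempty (G ≃* DihedralGroup n) := by
  have : NeZero n := ⟨by omega⟩
  have : Finite G := Nat.finite_of_card_ne_zero (by omega)
  obtain ⟨s, hs⟩ : ∃ s, s ∉ C := by
    by_contra! hall
    rw [(Subgroup.eq_top_iff' C).mpr hall, Subgroup.card_top] at hC
    omega
  let e : Multiplicative (ZMod n) ≃* C := hC ▸ zmodCyclicMulEquiv (inferInstance : IsCyclic C)
  let c : ZMod n → G := fun i => (e (Multiplicative.ofAdd i) : C)
  have hcC (i : ZMod n) : c i ∈ C := (e _).2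
  have hadd (i j : ZMod n) : c (i + j) = c i * c j := by
    simp only [c, ofAdd_add, map_mul, Subgroup.coe_mul]
  have hzero : c 0 = 1 := by simp [c]
  have hcinj : Function.Injective c :=
    Subtype.val_injective.comp (e.injective.comp Multiplicative.ofAdd.injective)
  have hss : s * s = 1 := h s hs
  have hcs (i : ZMod n) : c i * s = s * c (-i) := by
    have h1 : (s * c i) * (s * c i) = 1 :=
      h _ fun hm => hs ((C.mul_mem_cancel_right (hcC i)).mp hm)
    have h2 : c i * c (-i) = 1 := by rw [← hadd, add_neg_cancel, hzero]
    calc c i * s = (s * s) * (c i * s * (c i * c (-i))) := by rw [hss, h2, one_mul, mul_one]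
      _ = s * ((s * c i) * (s * c i)) * c (-i) := by simp only [mul_assoc]
      _ = s * c (-i) := by rw [h1, mul_one]
  let φ : DihedralGroup n →* G :=
    { toFun := fun x => match x with
        | .r i => c i
        | .sr i => s * c i
      map_one' := hzero
      map_mul' := by
        rintro (i | i) (j | j)
        · exact hadd i j
        · change s * c (j - i) = c i * (s * c j)
          rw [← mul_assoc, hcs, mul_assoc, ← hadd, neg_add_eq_sub]
        · change s * c (i + j) = s * c i * c j
          rw [hadd, mul_assoc]
        · change c (j - i) = s * c i * (s * c j)
          rw [mul_assoc, ← mul_assoc (c i), hcs, mul_assoc, ← mul_assoc s s, hss, one_mul,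
            ← hadd, neg_add_eq_sub] }
  have hφ : Function.Injective φ := by
    rw [injective_iff_map_eq_one]
    rintro (i | i) hi
    · have : i = 0 := hcinj (hi.trans hzero.symm)
      rw [this]
      rfl
    · change s * c i = 1 at hi
      exact (hs ((C.mul_mem_cancel_right (hcC i)).mp (hi ▸ C.one_mem))).elim
  refine ⟨(MulEquiv.ofBijective φ ((Nat.bijective_iff_injective_and_card φ).mpr
    ⟨hφ, ?_⟩)).symm⟩
  rw [hG, DihedralGroup.nat_card]

theorem nonempty_mulEquiv_perm_fin {G α : Type*} [Group G] {n : ℕ} (f : G →* Equiv.Perm α)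
    (hf : Function.Injective f) (hα : Nat.card α = n) (hn : n ≠ 0)
    (hG : Nat.card G = n.factorial) : Nonempty (G ≃* Equiv.Perm (Fin n)) := by
  have : Finite α := Nat.finite_of_card_ne_zero (hα ▸ hn)
  refine ⟨(MulEquiv.ofBijective f ((Nat.bijective_iff_injective_and_card f).mpr
    ⟨hf, ?_⟩)).trans (Finite.equivFinOfCardEq hα).permCongrHom⟩
  rw [hG, Nat.card_perm, hα]

theorem nonempty_mulEquiv_alternatingGroup_fin {G α : Type*} [Group G] {n : ℕ}
    (f : G →* Equiv.Perm α) (hf : Function.Injective f) (hα : Nat.card α = n) (hn : n ≠ 0)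
    (hG : Nat.card G * 2 = n.factorial) : Nonempty (G ≃* alternatingGroup (Fin n)) := by
  have : Finite α := Nat.finite_of_card_ne_zero (hα ▸ hn)
  let e := Finite.equivFinOfCardEq hα
  let φ : G →* Equiv.Perm (Fin n) := (e.permCongrHom : _ →* Equiv.Perm (Fin n)).comp f
  have hφ : Function.Injective φ := e.permCongrHom.injective.comp hf
  have hr : Nat.card φ.range = Nat.card G :=
    (Nat.card_congr (MonoidHom.ofInjective hφ).toEquiv).symm
  have hi : φ.range.index = 2 := by
    have h := φ.range.card_mul_index
    rw [hr, Nat.card_perm, Nat.card_fin, ← hG] at h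
    exact Nat.eq_of_mul_eq_mul_left (Nat.pos_of_ne_zero fun h0 => n.factorial_ne_zero (by
      rw [← hG, h0, zero_mul])) h
  refine ⟨(MonoidHom.ofInjective hφ).trans (MulEquiv.subgroupCongr ?_)⟩
  exact Equiv.Perm.eq_alternatingGroup_of_index_eq_two hi

end Recognition

section PolyhedralGroups

theorem ker_toPermHom_sylow_le_normalizer {G : Type*} [Group G] {p : ℕ} (P : Sylow p G) :
    (toPermHom G (Sylow p G)).ker ≤ normalizer (P : Set G) := by
  intro g hg
  rw [← Sylow.smul_eq_iff_mem_normalizer]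
  exact congrArg (fun σ : Equiv.Perm (Sylow p G) => σ P) hg

variable {G S : Type*} [Group G] [MulAction G S]

theorem nonempty_mulEquiv_dihedralGroup_of_orbit [Finite G]
    (h2 : ∀ g : G, g ≠ 1 → Nat.card (fixedBy S g) = 2)
    (hst : ∀ x : S, 2 ≤ Nat.card (stabilizer G x)) (x : S) [IsCyclic (stabilizer G x)]
    (hG : Nat.card G = 2 * Nat.card (stabilizer G x))
    (hr : ∀ y : S, y ∈ orbit G x ∨ Nat.card (stabilizer G y) = 2) :
    Nonempty (G ≃* DihedralGroup (Nat.card (stabilizer G x))) := by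
  refine nonempty_mulEquiv_dihedralGroup (hst x) hG _ rfl fun g hg => ?_
  have hi : (stabilizer G x).index = 2 := by
    have h := (stabilizer G x).card_mul_index
    rw [hG, mul_comm 2] at h
    exact Nat.eq_of_mul_eq_mul_left Nat.card_pos h
  have hn := normal_of_index_eq_two hi
  have h1 : g ≠ 1 := fun h => hg (h ▸ one_mem _)
  obtain ⟨y, hy⟩ := exists_smul_eq_self h2 h1
  rcases hr y with ⟨k, rfl⟩ | h
  · refine (hg ?_).elim
    have : k⁻¹ * g * k ∈ stabilizer G x := by
      rw [mem_stabilizer_iff, mul_smul, mul_smul, inv_smul_eq_iff]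
      exact hy
    simpa [mul_assoc] using hn.conj_mem _ this k
  · have h' := pow_card_eq_one' (x := (⟨g, hy⟩ : stabilizer G y))
    rw [h, pow_two] at h'
    exact congrArg Subtype.val h'

theorem nonempty_mulEquiv_alternatingGroup_four [Finite S]
    (h2 : ∀ g : G, g ≠ 1 → Nat.card (fixedBy S g) = 2) (hG : Nat.card G = 12) (x : S)
    (hx : Nat.card (stabilizer G x) = 3) : Nonempty (G ≃* alternatingGroup (Fin 4)) := by
  have ho : Nat.card (orbit G x) = 4 := by
    have h := card_orbit_mul_card_stabilizer (G := G) x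
    rw [hx, hG] at h
    omega
  refine nonempty_mulEquiv_alternatingGroup_fin (toPermHom G (orbit G x)) ?_ ho (by decide)
    (by rw [hG]; rfl)
  rw [injective_iff_map_eq_one]
  intro g hg
  by_contra h1
  have : Nat.card (orbit G x) ≤ Nat.card (fixedBy S g) := by
    refine Nat.card_mono (Set.toFinite _) fun y hy => ?_
    have h := congrArg (fun σ : Equiv.Perm (orbit G x) => (σ ⟨y, hy⟩ : S)) hg
    exact h
  rw [h2 g h1, ho] at this
  omega

variable [Finite G] [Finite S]

theorem nonempty_mulEquiv_perm_four
    (h2 : ∀ g : G, g ≠ 1 → Nat.card (fixedBy S g) = 2) (hG : Nat.card G = 24)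
    (hr : ∀ y : S, Nat.card (stabilizer G y) = 2 ∨ Nat.card (stabilizer G y) = 3 ∨
      Nat.card (stabilizer G y) = 4) : Nonempty (G ≃* Equiv.Perm (Fin 4)) := by
  have := Fact.mk Nat.prime_three
  have hthree (K : Subgroup G) [K.Normal] (hK : 3 ∣ Nat.card K) : 9 ≤ Nat.card K := by
    have h := card_mul_le_of_normal_of_prime_dvd h2 K Nat.prime_three
      (fun y hy => by rcases hr y with h | h | h <;> omega) hK
    omega
  let P : Sylow 3 G := default
  have hP : Nat.card P = 3 := by
    rw [P.card_eq_multiplicity, hG, show 24 = 3 ^ 1 * 8 by norm_num,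
      Nat.factorization_mul (by norm_num) (by norm_num)]
    simp [Nat.prime_three.factorization, Nat.factorization_eq_zero_of_not_dvd]
  have hPi : P.index = 8 := by
    have h := (P : Subgroup G).card_mul_index
    rw [hG] at h
    change Nat.card P * _ = _ at h
    rw [hP] at h
    omega
  have hn : Nat.card (Sylow 3 G) = 4 := by
    have hd := P.card_dvd_index
    have hm : Nat.card (Sylow 3 G) % 3 = 1 := card_sylow_modEq_one 3 G
    rw [hPi] at hd
    have hle := Nat.le_of_dvd (by norm_num) hd
    have h1 : Nat.card (Sylow 3 G) ≠ 1 := by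
      intro h
      have := (Nat.card_eq_one_iff_unique.mp h).1
      have := P.normal_of_subsingleton
      have := hthree P (dvd_of_eq hP.symm)
      change 9 ≤ Nat.card P at this
      omega
    interval_cases Nat.card (Sylow 3 G) <;> omega
  have hnorm : Nat.card (normalizer (P : Set G)) = 6 := by
    have h := (normalizer (P : Set G)).card_mul_index
    rw [← P.card_eq_index_normalizer, hG, hn] at h
    omega
  refine nonempty_mulEquiv_perm_fin (toPermHom G (Sylow 3 G)) ?_ hn (by decide)
    (by rw [hG]; rfl)
  rw [← MonoidHom.ker_eq_bot_iff]
  by_contra hbot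
  have hd := card_dvd_of_le (ker_toPermHom_sylow_le_normalizer P)
  rw [hnorm] at hd
  have h3 := hthree (toPermHom G (Sylow 3 G)).ker
  obtain ⟨y, hy⟩ := exists_card_le_of_normal h2 _ hbot
  rw [hG] at hy
  have hle := Nat.le_of_dvd (by norm_num) hd
  generalize Nat.card (toPermHom G (Sylow 3 G)).ker = k at *
  have : k = 1 ∨ k = 2 ∨ 3 ∣ k := by interval_cases k <;> omega
  rcases hr y with h | h | h <;> rw [h] at hy <;> omega

theorem nonempty_mulEquiv_alternatingGroup_five
    (h2 : ∀ g : G, g ≠ 1 → Nat.card (fixedBy S g) = 2) (hG : Nat.card G = 60)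
    (hr : ∀ y : S, Nat.card (stabilizer G y) = 2 ∨ Nat.card (stabilizer G y) = 3 ∨
      Nat.card (stabilizer G y) = 5)
    (ho : ∀ x y : S, Nat.card (stabilizer G x) = 2 → Nat.card (stabilizer G y) = 2 →
      y ∈ orbit G x) : Nonempty (G ≃* alternatingGroup (Fin 5)) := by
  have := Fact.mk Nat.prime_two
  have htwo (K : Subgroup G) [K.Normal] (hK : 2 ∣ Nat.card K) : 16 ≤ Nat.card K := by
    have h := card_mul_le_of_normal_of_prime_dvd h2 K Nat.prime_two
      (fun y hy => by rcases hr y with h | h | h <;> omega) hK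
    omega
  have hthree (K : Subgroup G) [K.Normal] (hK : 3 ∣ Nat.card K) : 21 ≤ Nat.card K := by
    have h := card_mul_le_of_normal_of_prime_dvd h2 K Nat.prime_three
      (fun y hy => by rcases hr y with h | h | h <;> omega) hK
    omega
  have hfive (K : Subgroup G) [K.Normal] (hK : 5 ∣ Nat.card K) : 25 ≤ Nat.card K := by
    have h := card_mul_le_of_normal_of_prime_dvd h2 K Nat.prime_five
      (fun y hy => by rcases hr y with h | h | h <;> omega) hK
    omega
  let P : Sylow 2 G := default
  have hP : Nat.card P = 4 := by
    rw [P.card_eq_multiplicity, hG, show 60 = 2 ^ 2 * 15 by norm_num,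
      Nat.factorization_mul (by norm_num) (by norm_num), Nat.prime_two.factorization_pow]
    simp [Nat.factorization_eq_zero_of_not_dvd]
  have hcomm : ∀ a ∈ P, ∀ b ∈ P, a * b = b * a := by
    intro a ha b hb
    have := IsPGroup.isMulCommutative_of_card_eq_prime_sq (p := 2) (G := P) hP
    exact congrArg Subtype.val (mul_comm' (⟨a, ha⟩ : P) ⟨b, hb⟩)
  have hfix : ∀ z ∈ P, z ≠ 1 → ∃ y : S, z • y = y ∧ Nat.card (stabilizer G y) = 2 := by
    intro z hz h1
    obtain ⟨y, hy⟩ := exists_smul_eq_self h2 h1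
    refine ⟨y, hy, ?_⟩
    have hd : orderOf z ∣ 4 := hP ▸ Subgroup.orderOf_dvd_natCard (P : Subgroup G) hz
    have hd' : orderOf z ∣ Nat.card (stabilizer G y) := Subgroup.orderOf_dvd_natCard _ hy
    have hne : orderOf z ≠ 1 := by rwa [Ne, orderOf_eq_one_iff]
    have hle := Nat.le_of_dvd (by norm_num) hd
    rcases hr y with h | h | h
    · exact h
    all_goals
      rw [h] at hd'
      interval_cases orderOf z <;> omega
  have hcent : ∀ z ∈ P, z ≠ 1 → (P : Subgroup G) = centralizer {z} := by
    intro z hz h1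
    obtain ⟨y, hy, hy2⟩ := hfix z hz h1
    refine Subgroup.eq_of_le_of_card_ge ?_ ?_
    · intro a ha
      rw [mem_centralizer_singleton_iff]
      exact hcomm a ha z hz
    · have := card_centralizer_le h2 h1 hy
      omega
  have hdvd : 4 ∣ Nat.card (normalizer (P : Set G)) := by
    rw [← hP]
    exact card_dvd_of_le le_normalizer
  have hcardN : Nat.card (normalizer (P : Set G)) * Nat.card (Sylow 2 G) = 60 := by
    rw [P.card_eq_index_normalizer, card_mul_index, hG]
  obtain ⟨g, hgN, hgP⟩ : ∃ g ∈ normalizer (P : Set G), g ∉ P := by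
    have hPc : (P : Set G).ncard = 4 := hP
    obtain ⟨z₁, hz₁, hz₁'⟩ := Set.exists_mem_notMem_of_ncard_lt_ncard
      (s := {1}) (t := (P : Set G)) (by rw [hPc, Set.ncard_singleton]; norm_num)
    obtain ⟨z₂, hz₂, hz₂'⟩ := Set.exists_mem_notMem_of_ncard_lt_ncard
      (s := {1, z₁}) (t := (P : Set G)) (by
        rw [hPc]
        exact (Set.ncard_insert_le _ _).trans_lt (by rw [Set.ncard_singleton]; norm_num))
    simp only [Set.mem_singleton_iff, Set.mem_insert_iff, not_or] at hz₁' hz₂'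
    obtain ⟨x₁, hx₁, hr₁⟩ := hfix z₁ hz₁ hz₁'
    obtain ⟨x₂, hx₂, hr₂⟩ := hfix z₂ hz₂ hz₂'.1
    obtain ⟨g, rfl⟩ := ho x₁ x₂ hr₁ hr₂
    change z₂ • g • x₁ = g • x₁ at hx₂
    have hx₂' : (g * z₁ * g⁻¹) • g • x₁ = g • x₁ := by simp [mul_smul, hx₁]
    have hconj : g * z₁ * g⁻¹ = z₂ := by
      obtain ⟨w, -, hw⟩ := (Nat.card_eq_two_iff' (1 : stabilizer G (g • x₁))).mp hr₂
      have e₁ := hw ⟨_, hx₂'⟩ (by simpa [Subtype.ext_iff] using hz₁')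
      have e₂ := hw ⟨_, hx₂⟩ (by simpa [Subtype.ext_iff] using hz₂'.1)
      exact congrArg Subtype.val (e₁.trans e₂.symm)
    refine ⟨g, ?_, fun hg => ?_⟩
    · rw [mem_set_normalizer_iff]
      intro a
      have ha (b : G) : b ∈ (P : Set G) ↔ b * z₁ = z₁ * b := by
        rw [← mem_centralizer_singleton_iff, ← hcent z₁ hz₁ hz₁']
        rfl
      have ha' (b : G) : b ∈ (P : Set G) ↔ b * z₂ = z₂ * b := by
        rw [← mem_centralizer_singleton_iff, ← hcent z₂ hz₂ hz₂'.1]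
        rfl
      rw [ha, ha', ← hconj]
      simp only [mul_assoc, mul_right_inj, inv_mul_cancel_left]
      rw [← mul_assoc, ← mul_assoc, mul_left_inj]
    · exact hz₂'.2 (by rw [← hconj, hcomm g hg z₁ hz₁, mul_inv_cancel_right])
  have hne : Nat.card (normalizer (P : Set G)) ≠ 4 := by
    intro h
    have heq := Subgroup.eq_of_le_of_card_ge (le_normalizer (H := (P : Subgroup G)))
      (h.trans hP.symm).le
    exact hgP (show g ∈ (P : Subgroup G) from heq ▸ hgN)
  have hn : Nat.card (Sylow 2 G) = 5 := by
    have h1 : Nat.card (Sylow 2 G) ≠ 1 := by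
      intro h
      have := (Nat.card_eq_one_iff_unique.mp h).1
      have := P.normal_of_subsingleton
      have := htwo P ((by norm_num : 2 ∣ 4).trans (dvd_of_eq hP.symm))
      change 16 ≤ Nat.card P at this
      omega
    have h3 : Nat.card (Sylow 2 G) ≠ 3 := by
      intro h
      rw [h] at hcardN
      let f := toPermHom G (Sylow 2 G)
      have hk : Nat.card f.ker * Nat.card f.range = 60 := by
        rw [← index_ker, card_mul_index, hG]
      have hle : Nat.card f.range ≤ 6 := by
        refine (card_le_card_group f.range).trans ?_
        rw [Nat.card_perm, h]
        rfl
      have hd : Nat.card f.ker ∣ 20 := by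
        rw [show 20 = Nat.card (normalizer (P : Set G)) by omega]
        exact card_dvd_of_le (ker_toPermHom_sylow_le_normalizer P)
      have h5 := hfive f.ker
      have hle' := Nat.le_of_dvd (by norm_num) hd
      interval_cases Nat.card f.ker <;> omega
    obtain ⟨m, hm⟩ := hdvd
    rw [hm] at hcardN hne
    have hd : Nat.card (Sylow 2 G) ∣ 15 := ⟨m, by linarith⟩
    have hle := Nat.le_of_dvd (by norm_num) hd
    interval_cases Nat.card (Sylow 2 G) <;> omega
  have hnorm : Nat.card (normalizer (P : Set G)) = 12 := by
    rw [hn] at hcardN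
    omega
  refine nonempty_mulEquiv_alternatingGroup_fin (toPermHom G (Sylow 2 G)) ?_ hn (by decide)
    (by rw [hG]; rfl)
  rw [← MonoidHom.ker_eq_bot_iff]
  have hd := card_dvd_of_le (ker_toPermHom_sylow_le_normalizer P)
  rw [hnorm] at hd
  have h3 := hthree (toPermHom G (Sylow 2 G)).ker
  have h2' := htwo (toPermHom G (Sylow 2 G)).ker
  have hle := Nat.le_of_dvd (by norm_num) hd
  rw [← Subgroup.card_eq_one]
  interval_cases Nat.card (toPermHom G (Sylow 2 G)).ker <;> omega

end PolyhedralGroups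

section ProjectiveLine

open Matrix OnePoint

open scoped Classical in
/-- `PGL₂(ℂ)` acts on the projective line by Möbius transformations. -/
noncomputable instance PGL2.instMulActionOnePoint : MulAction (PGL2 ℂ) (OnePoint ℂ) :=
  ProjGenLinGroup.mulActionOfGL (n := Fin 2) fun u a => by
    cases a with
    | infty => simp [smul_infty_eq_ite, GeneralLinearGroup.scalar]
    | coe c => simp [smul_some_eq_ite, GeneralLinearGroup.scalar]

open scoped Classical in
theorem PGL2.mk_smul (A : GL (Fin 2) ℂ) (x : OnePoint ℂ) : (A : PGL2 ℂ) • x = A • x := rfl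

theorem GL2.mk_ne_one_iff (A : GL (Fin 2) ℂ) :
    (A : PGL2 ℂ) ≠ 1 ↔ A.val ∉ Set.range (Matrix.scalar (Fin 2)) := by
  rw [Ne, QuotientGroup.eq_one_iff, GeneralLinearGroup.mem_center_iff_val_mem_range_scalar]

theorem GL2.discr_ne_zero {A : GL (Fin 2) ℂ} (h1 : (A : PGL2 ℂ) ≠ 1)
    (hf : IsOfFinOrder (A : PGL2 ℂ)) : A.val.discr ≠ 0 := by
  intro hd
  have hp : A.IsParabolic := ⟨(GL2.mk_ne_one_iff A).mp h1, hd⟩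
  obtain ⟨n, hn, hA⟩ := isOfFinOrder_iff_pow_eq_one.mp hf
  refine (GL2.mk_ne_one_iff (A ^ n)).mpr (hp.pow hn.ne').1 ?_
  exact hA

theorem PGL2.card_fixedBy {g : PGL2 ℂ} (h1 : g ≠ 1) (hf : IsOfFinOrder g) :
    Nat.card (fixedBy (OnePoint ℂ) g) = 2 := by
  classical
  induction g using QuotientGroup.induction_on with | H A =>
  have hd := GL2.discr_ne_zero h1 hf
  rw [discr_fin_two, trace_fin_two, det_fin_two] at hd
  have hcoe (c : ℂ) : (A : PGL2 ℂ) • (c : OnePoint ℂ) = c ↔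
      A 1 0 * c ^ 2 + (A 1 1 - A 0 0) * c - A 0 1 = 0 := by
    rw [PGL2.mk_smul, ← GeneralLinearGroup.fixpointPolynomial_aeval_eq_zero_iff]
    simp [GeneralLinearGroup.fixpointPolynomial]
  have hinf : (A : PGL2 ℂ) • (∞ : OnePoint ℂ) = ∞ ↔ A 1 0 = 0 := by
    rw [PGL2.mk_smul, smul_infty_eq_self_iff]
  rw [Nat.card_coe_set_eq, Set.ncard_eq_two]
  by_cases hc : A 1 0 = 0
  · have had : A 1 1 - A 0 0 ≠ 0 := by
      intro h
      apply hd
      grind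
    refine ⟨∞, ((A 0 1 / (A 1 1 - A 0 0) : ℂ) : OnePoint ℂ), infty_ne_coe _, ?_⟩
    ext x
    cases x with
    | infty => simp [hinf, hc]
    | coe c =>
      simp only [mem_fixedBy, hcoe, Set.mem_insert_iff, Set.mem_singleton_iff, coe_ne_infty,
        false_or, coe_eq_coe, hc, eq_div_iff had]
      constructor <;> intro h <;> linear_combination h
  · obtain ⟨s, hs⟩ := IsAlgClosed.exists_pow_nat_eq
      ((A 0 0 + A 1 1) ^ 2 - 4 * (A 0 0 * A 1 1 - A 0 1 * A 1 0)) two_pos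
    have hs0 : s ≠ 0 := by
      rintro rfl
      exact hd (by simpa using hs.symm)
    refine ⟨(((A 0 0 - A 1 1 + s) / (2 * A 1 0) : ℂ) : OnePoint ℂ),
      (((A 0 0 - A 1 1 - s) / (2 * A 1 0) : ℂ) : OnePoint ℂ), ?_, ?_⟩
    · rw [Ne, coe_eq_coe]
      intro h
      field_simp at h
      apply hs0
      linear_combination h / 2
    ext x
    cases x with
    | infty => simp [hinf, hc]
    | coe c =>
      simp only [mem_fixedBy, hcoe, Set.mem_insert_iff, Set.mem_singleton_iff, coe_eq_coe]
      rw [eq_div_iff (by simp [hc]), eq_div_iff (by simp [hc]), ← sub_eq_zero (b := _ + s),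
        ← sub_eq_zero (b := _ - s), ← mul_eq_zero]
      constructor
      · intro h
        linear_combination 4 * A 1 0 * h - hs
      · intro h
        have : 4 * A 1 0 * (A 1 0 * c ^ 2 + (A 1 1 - A 0 0) * c - A 0 1) = 0 := by
          linear_combination h + hs
        simpa [hc] using this

theorem PGL2.exists_smul_infty_eq (p : OnePoint ℂ) : ∃ g : PGL2 ℂ, g • (∞ : OnePoint ℂ) = p := by
  classical
  cases p with
  | infty => exact ⟨1, one_smul _ _⟩
  | coe t =>
    refine ⟨(GeneralLinearGroup.mkOfDetNeZero !![t, 1; 1, 0] (by simp) : GL (Fin 2) ℂ), ?_⟩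
    rw [PGL2.mk_smul, smul_infty_eq_ite]
    simp [GeneralLinearGroup.mkOfDetNeZero]

theorem GL2.div_eq_div_of_mk_eq {A B : GL (Fin 2) ℂ} (h : (A : PGL2 ℂ) = B) :
    A 1 1 / A 0 0 = B 1 1 / B 0 0 := by
  rw [QuotientGroup.eq, GeneralLinearGroup.center_eq_range_scalar] at h
  obtain ⟨u, hu⟩ := h
  obtain rfl : B = A * GeneralLinearGroup.scalar (Fin 2) u := by rw [hu, mul_inv_cancel_left]
  simp [GeneralLinearGroup.scalar, mul_div_mul_right]

/-- The quotient of the diagonal entries of a matrix representing an element of `PGL₂(ℂ)`. -/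
noncomputable def PGL2.diagRatio (g : PGL2 ℂ) : ℂ :=
  let A : GL (Fin 2) ℂ := Quotient.out g
  A 1 1 / A 0 0

theorem PGL2.diagRatio_mk (A : GL (Fin 2) ℂ) : PGL2.diagRatio A = A 1 1 / A 0 0 :=
  GL2.div_eq_div_of_mk_eq (QuotientGroup.out_eq' _)

/-- The derivative at `∞` of a Möbius transformation that fixes `∞`. -/
noncomputable def PGL2.multiplier : stabilizer (PGL2 ℂ) (∞ : OnePoint ℂ) →* ℂ where
  toFun g := PGL2.diagRatio g.1
  map_one' := (PGL2.diagRatio_mk 1).trans (by simp)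
  map_mul' := by
    classical
    rintro ⟨g, hg⟩ ⟨h, hh⟩
    induction g using QuotientGroup.induction_on with | H A =>
    induction h using QuotientGroup.induction_on with | H B =>
    rw [mem_stabilizer_iff, PGL2.mk_smul, smul_infty_eq_self_iff] at hg hh
    change PGL2.diagRatio ((A * B : GL (Fin 2) ℂ) : PGL2 ℂ) = _
    simp only [PGL2.diagRatio_mk]
    simp [Matrix.mul_apply, Fin.sum_univ_two, hg, hh, mul_div_mul_comm]

theorem PGL2.eq_one_of_multiplier_eq_one {g : stabilizer (PGL2 ℂ) (∞ : OnePoint ℂ)}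
    (hf : IsOfFinOrder g) (hg : PGL2.multiplier g = 1) : g = 1 := by
  classical
  replace hf : IsOfFinOrder g.1 := (Subgroup.subtype _).isOfFinOrder hf
  obtain ⟨g, hc⟩ := g
  refine Subtype.ext ?_
  by_contra h1
  induction g using QuotientGroup.induction_on with | H A =>
  rw [mem_stabilizer_iff, PGL2.mk_smul, smul_infty_eq_self_iff] at hc
  apply GL2.discr_ne_zero h1 hf
  have h : A 1 1 = A 0 0 := eq_of_div_eq_one ((PGL2.diagRatio_mk A).symm.trans hg)
  rw [discr_fin_two, trace_fin_two, det_fin_two]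
  grind

theorem PGL2.isCyclic_stabilizer (H : Subgroup (PGL2 ℂ)) [Finite H] (p : OnePoint ℂ) :
    IsCyclic (stabilizer H p) := by
  obtain ⟨m, hm⟩ := PGL2.exists_smul_infty_eq p
  let e := stabilizerEquivStabilizer hm.symm
  let i : stabilizer H p →* stabilizer (PGL2 ℂ) p :=
    { toFun := fun g => ⟨g.1.1, g.2⟩
      map_one' := rfl
      map_mul' := fun _ _ => rfl }
  refine isCyclic_of_injective_ringHom
    (PGL2.multiplier.comp ((e.symm : _ →* stabilizer (PGL2 ℂ) (∞ : OnePoint ℂ)).comp i)) ?_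
  rw [injective_iff_map_eq_one]
  intro g hg
  have h : e.symm (i g) = 1 := by
    refine PGL2.eq_one_of_multiplier_eq_one ?_ hg
    exact ((e.symm : _ →* stabilizer (PGL2 ℂ) (∞ : OnePoint ℂ)).comp i).isOfFinOrder
      (isOfFinOrder_of_finite g)
  have h' : i g = 1 := by simpa using h
  have h'' : g.1.1 = 1 := congrArg Subtype.val h'
  exact Subtype.ext (Subtype.ext h'')

end ProjectiveLine

section Classification

theorem nonempty_mulEquiv_zmod {G : Type*} [Group G] [Finite G] [IsCyclic G] :
    ∃ r : ℕ, 1 ≤ r ∧ Nonempty (G ≃* Multiplicative (ZMod r)) :=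
  ⟨Nat.card G, Nat.card_pos, ⟨(zmodCyclicMulEquiv (inferInstance : IsCyclic G)).symm⟩⟩

/-- The classification of finite groups acting on a finite set so that every nontrivial element
fixes exactly two points and all point stabilizers are cyclic and nontrivial. -/
theorem classification_of_card_fixedBy_eq_two {G S : Type*} [Group G] [Finite G] [MulAction G S]
    [Finite S] (h2 : ∀ g : G, g ≠ 1 → Nat.card (fixedBy S g) = 2)
    (hst : ∀ x : S, 2 ≤ Nat.card (stabilizer G x)) (hcyc : ∀ x : S, IsCyclic (stabilizer G x)) :
    (∃ r : ℕ, 1 ≤ r ∧ Nonempty (G ≃* Multiplicative (ZMod r))) ∨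
    (∃ r : ℕ, 2 ≤ r ∧ Nonempty (G ≃* DihedralGroup r)) ∨
    Nonempty (G ≃* alternatingGroup (Fin 4)) ∨
    Nonempty (G ≃* Equiv.Perm (Fin 4)) ∨
    Nonempty (G ≃* alternatingGroup (Fin 5)) := by
  have hN : 0 < Nat.card G := Nat.card_pos
  obtain hG | hG : Nat.card G = 1 ∨ 2 ≤ Nat.card G := by omega
  · have := (Nat.card_eq_one_iff_unique.mp hG).1
    exact Or.inl nonempty_mulEquiv_zmod
  have hlt := card_orbits_lt_four h2 hst
  have hadd := card_add_eq_card_orbits_mul h2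
  obtain h | h | h | h : Nat.card (orbitRel.Quotient G S) = 0 ∨
      Nat.card (orbitRel.Quotient G S) = 1 ∨ Nat.card (orbitRel.Quotient G S) = 2 ∨
      Nat.card (orbitRel.Quotient G S) = 3 := by omega
  · rw [h] at hadd
    omega
  · have hS : Nat.card S = 0 := by
      rw [h] at hadd
      omega
    have := Finite.card_eq_zero_iff.mp hS
    rw [Finite.card_eq_zero_iff.mpr (inferInstance : IsEmpty (orbitRel.Quotient G S))] at h
    omega
  · left
    have hS : Nat.card S = 2 := by
      rw [h] at hadd
      omega
    have hinj : Function.Injective (Quotient.mk'' : S → orbitRel.Quotient G S) :=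
      ((Nat.bijective_iff_surjective_and_card _).mpr
        ⟨Quotient.mk''_surjective, hS.trans h.symm⟩).1
    obtain ⟨x⟩ : Nonempty S := (Nat.card_ne_zero.mp (by omega)).1
    have hx (g : G) : g ∈ stabilizer G x :=
      hinj (Quotient.sound' (orbitRel_apply.mpr (mem_orbit x g)))
    have := hcyc x
    have : IsCyclic G := isCyclic_of_surjective (stabilizer G x).subtype fun g => ⟨⟨g, hx g⟩, rfl⟩
    exact nonempty_mulEquiv_zmod
  · right
    obtain ⟨x₁, x₂, x₃, hcov, hsum, h₁₂, h₂₃⟩ := exists_orbit_representatives_le h2 h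
    obtain ⟨e₁, h⟩ := orbit_type_arithmetic (card_orbit_mul_card_stabilizer x₁)
      (card_orbit_mul_card_stabilizer x₂) (card_orbit_mul_card_stabilizer x₃) hsum (hst x₁) h₁₂ h₂₃
    have hr (y : S) : Nat.card (stabilizer G y) = Nat.card (stabilizer G x₁) ∨
        Nat.card (stabilizer G y) = Nat.card (stabilizer G x₂) ∨
        Nat.card (stabilizer G y) = Nat.card (stabilizer G x₃) :=
      (hcov y).imp card_stabilizer_eq_of_mem_orbit
        (Or.imp card_stabilizer_eq_of_mem_orbit card_stabilizer_eq_of_mem_orbit)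
    rcases h with ⟨e₂, hN⟩ | ⟨e₂, ⟨e₃, hN⟩ | ⟨e₃, hN⟩ | ⟨e₃, hN⟩⟩
    · have := hcyc x₃
      refine Or.inl ⟨_, hst x₃, nonempty_mulEquiv_dihedralGroup_of_orbit h2 hst x₃ hN fun y => ?_⟩
      rcases hcov y with hy | hy | hy
      · exact Or.inr ((card_stabilizer_eq_of_mem_orbit hy).trans e₁)
      · exact Or.inr ((card_stabilizer_eq_of_mem_orbit hy).trans e₂)
      · exact Or.inl hy
    · exact Or.inr (Or.inl (nonempty_mulEquiv_alternatingGroup_four h2 hN x₃ e₃))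
    · simp only [e₁, e₂, e₃] at hr
      exact Or.inr (Or.inr (Or.inl (nonempty_mulEquiv_perm_four h2 hN hr)))
    · have ho (y : S) (hy : Nat.card (stabilizer G y) = 2) : y ∈ orbit G x₁ := by
        rcases hcov y with h | h | h
        · exact h
        all_goals
          have := card_stabilizer_eq_of_mem_orbit h
          omega
      simp only [e₁, e₂, e₃] at hr
      refine Or.inr (Or.inr (Or.inr (nonempty_mulEquiv_alternatingGroup_five h2 hN hr ?_)))
      intro x y hx hy
      rw [orbit_eq_iff.mpr (ho x hx)]
      exact ho y hy

/-- The points with nontrivial stabilizer, as an invariant subset. -/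
def nontrivialStabilizerPoints (G X : Type*) [Group G] [MulAction G X] : SubMulAction G X where
  carrier := {x | ∃ g : G, g ≠ 1 ∧ g • x = x}
  smul_mem' := by
    rintro k x ⟨g, h1, hx⟩
    exact ⟨k * g * k⁻¹, by simpa using h1, by simp [mul_smul, hx]⟩

end Classification

/-- Every finite subgroup of `PGL₂(ℂ)` is isomorphic to a cyclic group `ℤ/r` (`r ≥ 1`),
a dihedral group `D_r` of order `2r` (`r ≥ 2`), `A₄`, `S₄`, or `A₅`. -/
theorem finite_subgroup_pgl2_complex_classification
    (H : Subgroup (PGL2 ℂ)) (hH : Finite H) :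
    (∃ r : ℕ, 1 ≤ r ∧ Nonempty (H ≃* Multiplicative (ZMod r))) ∨
    (∃ r : ℕ, 2 ≤ r ∧ Nonempty (H ≃* DihedralGroup r)) ∨
    Nonempty (H ≃* alternatingGroup (Fin 4)) ∨
    Nonempty (H ≃* Equiv.Perm (Fin 4)) ∨
    Nonempty (H ≃* alternatingGroup (Fin 5)) := by
  have hX (g : H) (hg : g ≠ 1) : Nat.card (fixedBy (OnePoint ℂ) g) = 2 :=
    PGL2.card_fixedBy (g := g.1) (by simpa using hg)
      (H.subtype.isOfFinOrder (isOfFinOrder_of_finite g))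
  let S := nontrivialStabilizerPoints H (OnePoint ℂ)
  have hS : Finite S := by
    have hfin : (⋃ g : {g : H // g ≠ 1}, fixedBy (OnePoint ℂ) g.1).Finite :=
      Set.finite_iUnion fun g => Set.finite_of_ncard_ne_zero (by
        rw [← Nat.card_coe_set_eq, hX _ g.2]; decide)
    refine (hfin.subset ?_).to_subtype
    rintro x ⟨g, h1, hx⟩
    exact Set.mem_iUnion.mpr ⟨⟨g, h1⟩, hx⟩
  have hstab (x : S) : stabilizer H x = stabilizer H (x : OnePoint ℂ) := by
    ext g
    simp [mem_stabilizer_iff, Subtype.ext_iff]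
  refine classification_of_card_fixedBy_eq_two (S := S) ?_ ?_ ?_
  · intro g hg
    refine (Nat.card_congr ?_).trans (hX g hg)
    exact ⟨fun x => ⟨x.1.1, congrArg Subtype.val x.2⟩,
      fun x => ⟨⟨x.1, g, hg, x.2⟩, Subtype.ext x.2⟩, fun _ => rfl, fun _ => rfl⟩
  · intro x
    obtain ⟨g, h1, hx⟩ := x.2
    rw [hstab]
    refine one_lt_card_iff_ne_bot _ |>.mpr fun h => h1 ?_
    exact (Subgroup.eq_bot_iff_forall _).mp h g hx
  · intro x
    rw [hstab]
    exact PGL2.isCyclic_stabilizer H _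
end

section
/- Let F be a field of characteristic zero. Then the following are equivalent: (i) PGL₂(F) contains a subgroup isomorphic to the alternating group A₄; (ii) PGL₂(F) contains a subgroup isomorphic to the symmetric group S₄; (iii) −1 is a sum of two squares in F, i.e. there exist a, b ∈ F with a² + b² = −1. -/
open scoped MatrixGroups

open scoped Quaternion

/-- An integral quaternion whose conjugation action permutes the four
diagonals `i + j + k`, `i - j - k`, `-i + j - k`, `-i - j + k` of the cube according to the given
permutation. -/
def octahedralQuaternion (σ : Equiv.Perm (Fin 4)) : ℍ[ℤ] :=
  match σ 0, σ 1, σ 2 with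
  | 0, 1, 2 => ⟨1, 0, 0, 0⟩
  | 0, 1, 3 => ⟨0, 0, 1, -1⟩
  | 0, 2, 1 => ⟨0, 1, -1, 0⟩
  | 0, 2, 3 => ⟨1, 1, 1, 1⟩
  | 0, 3, 1 => ⟨1, -1, -1, -1⟩
  | 0, 3, 2 => ⟨0, 1, 0, -1⟩
  | 1, 0, 2 => ⟨0, 0, 1, 1⟩
  | 1, 0, 3 => ⟨0, 1, 0, 0⟩
  | 1, 2, 0 => ⟨1, 1, 1, -1⟩
  | 1, 2, 3 => ⟨1, 0, -1, 0⟩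
  | 1, 3, 0 => ⟨1, 0, 0, 1⟩
  | 1, 3, 2 => ⟨1, -1, 1, -1⟩
  | 2, 0, 1 => ⟨1, -1, -1, 1⟩
  | 2, 0, 3 => ⟨1, 0, 0, -1⟩
  | 2, 1, 0 => ⟨0, 1, 0, 1⟩
  | 2, 1, 3 => ⟨1, -1, 1, 1⟩
  | 2, 3, 0 => ⟨0, 0, 1, 0⟩
  | 2, 3, 1 => ⟨1, 1, 0, 0⟩
  | 3, 0, 1 => ⟨1, 0, 1, 0⟩
  | 3, 0, 2 => ⟨1, 1, -1, 1⟩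
  | 3, 1, 0 => ⟨1, 1, -1, -1⟩
  | 3, 1, 2 => ⟨0, 1, 1, 0⟩
  | 3, 2, 0 => ⟨1, -1, 0, 0⟩
  | 3, 2, 1 => ⟨0, 0, 0, 1⟩
  | _, _, _ => ⟨0, 0, 0, 0⟩

theorem octahedralQuaternion_mul (σ τ : Equiv.Perm (Fin 4)) :
    ∃ k ∈ ({1, -1, 2, -2, 4, -4} : Finset ℤ),
      octahedralQuaternion σ * octahedralQuaternion τ =
        (k : ℍ[ℤ]) * octahedralQuaternion (σ * τ) := by
  have key : ∀ σ τ : Equiv.Perm (Fin 4), ∃ k ∈ ({1, -1, 2, -2, 4, -4} : Finset ℤ),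
      let p := octahedralQuaternion σ
      let q := octahedralQuaternion τ
      let r := octahedralQuaternion (σ * τ)
      p.re * q.re - p.imI * q.imI - p.imJ * q.imJ - p.imK * q.imK = k * r.re ∧
      p.re * q.imI + p.imI * q.re + p.imJ * q.imK - p.imK * q.imJ = k * r.imI ∧
      p.re * q.imJ - p.imI * q.imK + p.imJ * q.re + p.imK * q.imI = k * r.imJ ∧
      p.re * q.imK + p.imI * q.imJ - p.imJ * q.imI + p.imK * q.re = k * r.imK := by
    decide +kernel
  obtain ⟨k, hk, h₀, h₁, h₂, h₃⟩ := key σ τ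
  exact ⟨k, hk, by ext <;> simp [h₀, h₁, h₂, h₃]⟩

theorem octahedralQuaternion_ne_zero (σ : Equiv.Perm (Fin 4)) : octahedralQuaternion σ ≠ 0 := by
  have key : ∀ σ : Equiv.Perm (Fin 4), ¬ ((octahedralQuaternion σ).re = 0 ∧
      (octahedralQuaternion σ).imI = 0 ∧ (octahedralQuaternion σ).imJ = 0 ∧
      (octahedralQuaternion σ).imK = 0) := by
    decide +kernel
  intro h
  exact key σ (by simp [h])

theorem eq_one_of_octahedralQuaternion_im_eq_zero (σ : Equiv.Perm (Fin 4))
    (hI : (octahedralQuaternion σ).imI = 0) (hJ : (octahedralQuaternion σ).imJ = 0)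
    (hK : (octahedralQuaternion σ).imK = 0) : σ = 1 := by
  revert σ
  decide +kernel

section

variable {F : Type*} [Field F]

/-- The matrix attached to an integral quaternion by the splitting of the quaternion algebra
`(-1, -1)` over `F` coming from a solution of `a ^ 2 + b ^ 2 = -1`. -/
def quaternionMatrix (a b : F) (q : ℍ[ℤ]) : Matrix (Fin 2) (Fin 2) F :=
  !![q.re + q.imJ * a + q.imK * b, q.imI + q.imJ * b - q.imK * a;
    -q.imI + q.imJ * b - q.imK * a, q.re - q.imJ * a - q.imK * b]

theorem quaternionMatrix_mul {a b : F} (hab : a ^ 2 + b ^ 2 = -1) (p q : ℍ[ℤ]) :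
    quaternionMatrix a b (p * q) = quaternionMatrix a b p * quaternionMatrix a b q := by
  ext i j
  fin_cases i <;> fin_cases j <;> simp [quaternionMatrix, Matrix.mul_apply] <;>
    grind

theorem quaternionMatrix_intCast (a b : F) (k : ℤ) :
    quaternionMatrix a b (k : ℍ[ℤ]) = Matrix.scalar (Fin 2) (k : F) := by
  ext i j
  fin_cases i <;> fin_cases j <;> simp [quaternionMatrix, -map_intCast]

theorem det_quaternionMatrix {a b : F} (hab : a ^ 2 + b ^ 2 = -1) (q : ℍ[ℤ]) :
    (quaternionMatrix a b q).det = ((q.re ^ 2 + q.imI ^ 2 + q.imJ ^ 2 + q.imK ^ 2 : ℤ) : F) := by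
  simp only [quaternionMatrix, Matrix.det_fin_two_of]
  push_cast
  linear_combination (-(q.imJ : F) ^ 2 - (q.imK : F) ^ 2) * hab

theorem det_quaternionMatrix_ne_zero [CharZero F] {a b : F} (hab : a ^ 2 + b ^ 2 = -1) {q : ℍ[ℤ]}
    (hq : q ≠ 0) : (quaternionMatrix a b q).det ≠ 0 := by
  rw [det_quaternionMatrix hab, Int.cast_ne_zero]
  contrapose! hq
  ext <;> simp <;> nlinarith [sq_nonneg q.re, sq_nonneg q.imI, sq_nonneg q.imJ, sq_nonneg q.imK]

theorem im_eq_zero_of_quaternionMatrix_eq_scalar [CharZero F] {a b : F} (hab : a ^ 2 + b ^ 2 = -1)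
    {q : ℍ[ℤ]} {r : F} (h : quaternionMatrix a b q = Matrix.scalar (Fin 2) r) :
    q.imI = 0 ∧ q.imJ = 0 ∧ q.imK = 0 := by
  have h₀₀ := congr_fun₂ h 0 0
  have h₀₁ := congr_fun₂ h 0 1
  have h₁₀ := congr_fun₂ h 1 0
  have h₁₁ := congr_fun₂ h 1 1
  simp [quaternionMatrix] at h₀₀ h₀₁ h₁₀ h₁₁
  have hI : (q.imI : F) = 0 := by linear_combination (h₀₁ - h₁₀) / 2
  have hu : q.imJ * a + q.imK * b = 0 := by linear_combination (h₀₀ - h₁₁) / 2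
  have hv : q.imJ * b - q.imK * a = 0 := by linear_combination (h₀₁ + h₁₀) / 2
  have hs : ((q.imJ ^ 2 + q.imK ^ 2 : ℤ) : F) = 0 := by
    push_cast
    linear_combination ((q.imJ : F) ^ 2 + (q.imK : F) ^ 2) * hab -
      (q.imJ * a + q.imK * b) * hu - (q.imJ * b - q.imK * a) * hv
  rw [Int.cast_eq_zero] at hI hs
  refine ⟨hI, ?_, ?_⟩ <;> nlinarith [sq_nonneg q.imJ, sq_nonneg q.imK]

theorem mk_eq_mk_of_val_eq_scalar_mul {A B : GL (Fin 2) F} {r : F}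
    (h : B.val = Matrix.scalar (Fin 2) r * A.val) : (A : PGL2 F) = B := by
  rw [QuotientGroup.eq, Matrix.GeneralLinearGroup.mem_center_iff_val_mem_range_scalar]
  refine ⟨r, ?_⟩
  rw [Units.val_mul, h, ← mul_assoc, (Matrix.scalar_commute r (Commute.all r) _).eq.symm, mul_assoc,
    Units.inv_mul, mul_one]

theorem exists_val_eq_smul_of_mk_eq_mk {A B : GL (Fin 2) F} (h : (A : PGL2 F) = B) :
    ∃ r : F, B.val = r • A.val := by
  rw [QuotientGroup.eq, Matrix.GeneralLinearGroup.mem_center_iff_val_mem_range_scalar] at h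
  obtain ⟨r, hr⟩ := h
  refine ⟨r, ?_⟩
  calc B.val = A.val * (A⁻¹ * B).val := by simp
    _ = r • A.val := by rw [← hr, Matrix.scalar_apply, ← Matrix.smul_one_eq_diagonal]; simp

/-- An embedding of `S₄` into `PGL₂(F)` from a solution of `a ^ 2 + b ^ 2 = -1`. -/
theorem exists_perm_hom_injective [CharZero F] {a b : F} (hab : a ^ 2 + b ^ 2 = -1) :
    ∃ f : Equiv.Perm (Fin 4) →* PGL2 F, Function.Injective f := by
  let g (σ : Equiv.Perm (Fin 4)) : GL (Fin 2) F :=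
    Matrix.GeneralLinearGroup.mkOfDetNeZero (quaternionMatrix a b (octahedralQuaternion σ))
      (det_quaternionMatrix_ne_zero hab (octahedralQuaternion_ne_zero σ))
  have hg (σ) : (g σ).val = quaternionMatrix a b (octahedralQuaternion σ) := rfl
  let f : Equiv.Perm (Fin 4) →* PGL2 F := MonoidHom.mk' (fun σ ↦ (g σ : PGL2 F)) <| by
    intro σ τ
    obtain ⟨k, -, h⟩ := octahedralQuaternion_mul σ τ
    refine mk_eq_mk_of_val_eq_scalar_mul (r := (k : F)) ?_
    rw [Units.val_mul, hg, hg, hg, ← quaternionMatrix_mul hab, h, quaternionMatrix_mul hab,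
      quaternionMatrix_intCast]
  refine ⟨f, (injective_iff_map_eq_one f).mpr fun σ hσ ↦ ?_⟩
  have hc : g σ ∈ Subgroup.center (GL (Fin 2) F) := (QuotientGroup.eq_one_iff _).mp hσ
  rw [Matrix.GeneralLinearGroup.mem_center_iff_val_mem_range_scalar] at hc
  obtain ⟨r, hr⟩ := hc
  obtain ⟨hI, hJ, hK⟩ := im_eq_zero_of_quaternionMatrix_eq_scalar hab hr.symm
  exact eq_one_of_octahedralQuaternion_im_eq_zero σ hI hJ hK

/-- Involutions of `PGL₂(F)` lift to matrices of trace zero. -/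
theorem trace_eq_zero_of_mk_mul_self {A : GL (Fin 2) F} (h₁ : (A : PGL2 F) ≠ 1)
    (h₂ : (A : PGL2 F) * A = 1) : A.val 1 1 = -A.val 0 0 := by
  obtain ⟨r, hr⟩ := exists_val_eq_smul_of_mk_eq_mk (A := 1) (B := A * A) h₂.symm
  have h₀₀ := congr_fun₂ hr 0 0
  have h₀₁ := congr_fun₂ hr 0 1
  have h₁₀ := congr_fun₂ hr 1 0
  have h₁₁ := congr_fun₂ hr 1 1
  simp [Matrix.mul_apply] at h₀₀ h₀₁ h₁₀ h₁₁
  by_contra ht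
  refine h₁ (mk_eq_mk_of_val_eq_scalar_mul (r := A.val 0 0) (A := 1) (B := A) ?_).symm
  have ht' : A.val 0 0 + A.val 1 1 ≠ 0 := fun h ↦ ht (by linear_combination h)
  have h01 : A.val 0 1 = 0 := by
    apply mul_right_cancel₀ ht'
    linear_combination h₀₁
  have h10 : A.val 1 0 = 0 := by
    apply mul_right_cancel₀ ht'
    linear_combination h₁₀
  have h11 : A.val 1 1 = A.val 0 0 := by
    apply mul_right_cancel₀ ht'
    linear_combination h₁₁ - h₀₀
  ext i j
  fin_cases i <;> fin_cases j <;> simp [h01, h10, h11]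

theorem exists_det_eq_sq_mul_det {A B C : GL (Fin 2) F}
    (h : (C : PGL2 F) * A = B * C) : ∃ r : F, B.val.det = r ^ 2 * A.val.det := by
  obtain ⟨r, hr⟩ := exists_val_eq_smul_of_mk_eq_mk (A := C * A) (B := B * C) h
  refine ⟨r, ?_⟩
  have hC : C.val.det ≠ 0 := Matrix.GeneralLinearGroup.det_ne_zero C
  have hd := congr_arg Matrix.det hr
  simp only [Units.val_mul, Matrix.det_smul, Matrix.det_mul, Fintype.card_fin] at hd
  apply mul_right_cancel₀ hC
  linear_combination hd

/-- If `PGL₂(F)` contains a four-group `{1, x, y, xy}` and an element conjugating `x` to `y` and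
`y` to `xy`, then `-1` is a sum of two squares. -/
theorem sum_two_squares_of_tetrahedral {x y c : PGL2 F} (hx : x ≠ 1) (hy : y ≠ 1)
    (hxy : x * y ≠ 1) (hx₂ : x * x = 1) (hy₂ : y * y = 1) (hxy₂ : (x * y) * (x * y) = 1)
    (hcx : c * x = y * c) (hcy : c * y = (x * y) * c) : ∃ a b : F, a ^ 2 + b ^ 2 = -1 := by
  obtain ⟨X, rfl⟩ := QuotientGroup.mk_surjective x
  obtain ⟨Y, rfl⟩ := QuotientGroup.mk_surjective y
  obtain ⟨C, rfl⟩ := QuotientGroup.mk_surjective c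
  have tX := trace_eq_zero_of_mk_mul_self hx hx₂
  have tY := trace_eq_zero_of_mk_mul_self hy hy₂
  have tXY := trace_eq_zero_of_mk_mul_self (A := X * Y) hxy hxy₂
  obtain ⟨r, hr⟩ := exists_det_eq_sq_mul_det hcx
  obtain ⟨s, hs⟩ := exists_det_eq_sq_mul_det (A := Y) (B := X * Y) hcy
  have dX : X.val.det ≠ 0 := Matrix.GeneralLinearGroup.det_ne_zero X
  have dY : Y.val.det ≠ 0 := Matrix.GeneralLinearGroup.det_ne_zero Y
  rw [Units.val_mul, Matrix.det_mul] at hs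
  replace hs : X.val.det = s ^ 2 := mul_right_cancel₀ dY hs
  replace hr : Y.val.det = (r * s) ^ 2 := by rw [hr, hs]; ring
  have hs₀ : s ≠ 0 := by rintro rfl; simp [hs] at dX
  have ht₀ : r * s ≠ 0 := by intro h; simp [hr, h] at dY
  generalize r * s = t at hr ht₀
  simp only [Units.val_mul, Matrix.mul_apply, Fin.sum_univ_two, Matrix.det_fin_two] at hr hs tXY
  generalize X.val 0 0 = p, X.val 0 1 = q, X.val 1 0 = u, X.val 1 1 = p' at *
  generalize Y.val 0 0 = d, Y.val 0 1 = e, Y.val 1 0 = v, Y.val 1 1 = d' at *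
  subst tX tY
  have key : (u * d - p * v) ^ 2 + (u * t) ^ 2 + (v * s) ^ 2 = 0 := by
    linear_combination (-u ^ 2) * hr - v ^ 2 * hs - u * v * tXY
  by_cases hu : u = 0
  · exact ⟨p / s, 0, by subst hu; field_simp; linear_combination -hs⟩
  · refine ⟨(u * d - p * v) / (u * t), v * s / (u * t), ?_⟩
    field_simp
    linear_combination key

end

theorem exists_sum_two_squares_of_alternatingGroup_hom {F : Type*} [Field F]
    (f : alternatingGroup (Fin 4) →* PGL2 F) (hf : Function.Injective f) :
    ∃ a b : F, a ^ 2 + b ^ 2 = -1 := by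
  obtain ⟨x, y, c, hx, hy, hxy, hx₂, hy₂, hxy₂, hcx, hcy⟩ :
      ∃ x y c : alternatingGroup (Fin 4), x ≠ 1 ∧ y ≠ 1 ∧ x * y ≠ 1 ∧ x * x = 1 ∧ y * y = 1 ∧
        (x * y) * (x * y) = 1 ∧ c * x = y * c ∧ c * y = (x * y) * c := by
    decide +kernel
  have hne {z} (hz : z ≠ 1) : f z ≠ 1 := (map_ne_one_iff f hf).mpr hz
  refine sum_two_squares_of_tetrahedral (x := f x) (y := f y) (c := f c) (hne hx) (hne hy) ?_ ?_ ?_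
    ?_ ?_ ?_ <;> simp only [← map_mul]
  exacts [hne hxy, by simp [hx₂], by simp [hy₂], by rw [hxy₂, map_one], by rw [hcx], by rw [hcy]]

/-- For a field `F` of characteristic zero, the following are equivalent:
`PGL₂(F)` contains a copy of `A₄`; `PGL₂(F)` contains a copy of `S₄`;
`-1` is a sum of two squares in `F`. -/
theorem pgl2_contains_A4_iff_S4_iff_sum_of_two_squares
    (F : Type*) [Field F] [CharZero F] :
    ((∃ H : Subgroup (PGL2 F), Nonempty (H ≃* alternatingGroup (Fin 4))) ↔
      (∃ H : Subgroup (PGL2 F), Nonempty (H ≃* Equiv.Perm (Fin 4)))) ∧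
    ((∃ H : Subgroup (PGL2 F), Nonempty (H ≃* alternatingGroup (Fin 4))) ↔
      (∃ a b : F, a ^ 2 + b ^ 2 = -1)) := by
  have h₁ : (∃ H : Subgroup (PGL2 F), Nonempty (H ≃* alternatingGroup (Fin 4))) →
      ∃ a b : F, a ^ 2 + b ^ 2 = -1 := fun ⟨H, ⟨e⟩⟩ ↦
    exists_sum_two_squares_of_alternatingGroup_hom (H.subtype.comp e.symm.toMonoidHom)
      (H.subtype_injective.comp e.symm.injective)
  have h₂ : (∃ a b : F, a ^ 2 + b ^ 2 = -1) →
      ∃ H : Subgroup (PGL2 F), Nonempty (H ≃* Equiv.Perm (Fin 4)) := fun ⟨a, b, hab⟩ ↦ by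
    obtain ⟨f, hf⟩ := exists_perm_hom_injective hab
    exact ⟨f.range, ⟨(MonoidHom.ofInjective hf).symm⟩⟩
  have h₃ : (∃ H : Subgroup (PGL2 F), Nonempty (H ≃* Equiv.Perm (Fin 4))) →
      ∃ H : Subgroup (PGL2 F), Nonempty (H ≃* alternatingGroup (Fin 4)) := fun ⟨H, ⟨e⟩⟩ ↦ by
    let f : alternatingGroup (Fin 4) →* PGL2 F :=
      (H.subtype.comp e.symm.toMonoidHom).comp (alternatingGroup (Fin 4)).subtype
    have hf : Function.Injective f :=
      (H.subtype_injective.comp e.symm.injective).comp (Subgroup.subtype_injective _)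
    exact ⟨f.range, ⟨(MonoidHom.ofInjective hf).symm⟩⟩
  exact ⟨⟨h₂ ∘ h₁, h₃⟩, ⟨h₁, h₃ ∘ h₂⟩⟩
end

section
/- Let F be a field of characteristic zero. Then PGL₂(F) contains a subgroup isomorphic to the alternating group A₅ if and only if −1 is a sum of two squares in F (there exist a, b ∈ F with a² + b² = −1) and 5 is a square in F (there exists s ∈ F with s² = 5). -/
open scoped MatrixGroups

namespace PGL2

section Projective

variable {F : Type*} [Field F]

lemma mk_eq_mk_iff_exists_smul {X Y : GL (Fin 2) F} :
    (QuotientGroup.mk X : PGL2 F) = QuotientGroup.mk Y ↔ ∃ c : F, Y.val = c • X.val := by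
  rw [QuotientGroup.eq, Matrix.GeneralLinearGroup.mem_center_iff_val_mem_range_scalar]
  constructor
  · rintro ⟨c, hc⟩
    refine ⟨c, ?_⟩
    have h : Y.val = X.val * (X⁻¹ * Y).val := by rw [← Units.val_mul, mul_inv_cancel_left]
    rw [h, ← hc, Matrix.scalar_apply, ← Matrix.smul_one_eq_diagonal, mul_smul_one]
  · rintro ⟨c, hc⟩
    refine ⟨c, ?_⟩
    rw [Units.val_mul, hc, mul_smul_comm, ← Units.val_mul, inv_mul_cancel, Matrix.scalar_apply,
      ← Matrix.smul_one_eq_diagonal, Units.val_one]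

lemma exists_smul_one_of_mk_eq_one {X : GL (Fin 2) F} (h : (QuotientGroup.mk X : PGL2 F) = 1) :
    ∃ c : F, X.val = c • (1 : Matrix (Fin 2) (Fin 2) F) :=
  mk_eq_mk_iff_exists_smul.1 ((QuotientGroup.mk_one _).trans h.symm)

end Projective

section Necessity

variable {F : Type*} [Field F]

lemma apply_ne_of_mk_ne_one {X : GL (Fin 2) F} (h : (QuotientGroup.mk X : PGL2 F) ≠ 1) :
    ¬ (X.val 0 1 = 0 ∧ X.val 1 0 = 0 ∧ X.val 0 0 = X.val 1 1) := by
  rintro ⟨h01, h10, h00⟩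
  refine h ((QuotientGroup.mk_one _).symm.trans (mk_eq_mk_iff_exists_smul.2 ⟨X.val 1 1, ?_⟩)).symm
  ext i j
  fin_cases i <;> fin_cases j <;> simp [h01, h10, h00]

lemma exists_sq_eq_five_of_pow_five {x : PGL2 F} (hx : x ^ 5 = 1) (h1 : x ≠ 1) :
    ∃ s : F, s ^ 2 = 5 := by
  induction x using QuotientGroup.induction_on with | H X => ?_
  have hn := apply_ne_of_mk_ne_one h1
  rw [← QuotientGroup.mk_pow] at hx
  obtain ⟨c, hc⟩ := exists_smul_one_of_mk_eq_one hx
  have hD : X.val.det ≠ 0 := X.det_ne_zero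
  rw [Units.val_pow_eq_pow_val] at hc
  generalize X.val = M at *
  obtain ⟨p, q, r, t, rfl⟩ : ∃ p q r t, M = !![p, q; r, t] := ⟨_, _, _, _, M.eta_fin_two⟩
  simp only [pow_succ, pow_zero, one_mul, Matrix.mul_fin_two, Matrix.one_fin_two,
    Matrix.smul_of, Matrix.smul_cons, Matrix.smul_empty, smul_eq_mul, mul_one, mul_zero,
    EmbeddingLike.apply_eq_iff_eq, Matrix.vecCons_inj, and_true] at hc
  obtain ⟨⟨h00, h01⟩, h10, h11⟩ := hc
  rw [Matrix.det_fin_two_of] at hD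
  simp only [Matrix.of_apply, Matrix.cons_val', Matrix.cons_val_zero, Matrix.cons_val_one,
    Matrix.cons_val_fin_one] at hn
  have key : (p + t) ^ 4 - 3 * (p + t) ^ 2 * (p * t - q * r) + (p * t - q * r) ^ 2 = 0 := by
    by_contra hk
    refine hn ⟨?_, ?_, ?_⟩
    · refine (mul_eq_zero.1 ?_).resolve_left hk
      linear_combination h01
    · refine (mul_eq_zero.1 ?_).resolve_left hk
      linear_combination h10
    · refine sub_eq_zero.1 ((mul_eq_zero.1 ?_).resolve_left hk)
      linear_combination h00 - h11
  refine ⟨(2 * (p + t) ^ 2 - 3 * (p * t - q * r)) / (p * t - q * r), ?_⟩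
  field_simp
  linear_combination 4 * key

lemma trace_eq_zero_of_sq {X : GL (Fin 2) F} (hx : (QuotientGroup.mk X : PGL2 F) ^ 2 = 1)
    (h1 : (QuotientGroup.mk X : PGL2 F) ≠ 1) : X.val.trace = 0 := by
  have hn := apply_ne_of_mk_ne_one h1
  rw [← QuotientGroup.mk_pow] at hx
  obtain ⟨c, hc⟩ := exists_smul_one_of_mk_eq_one hx
  rw [Units.val_pow_eq_pow_val] at hc
  generalize X.val = M at *
  obtain ⟨p, q, r, t, rfl⟩ : ∃ p q r t, M = !![p, q; r, t] := ⟨_, _, _, _, M.eta_fin_two⟩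
  simp only [pow_succ, pow_zero, one_mul, Matrix.mul_fin_two, Matrix.one_fin_two,
    Matrix.smul_of, Matrix.smul_cons, Matrix.smul_empty, smul_eq_mul, mul_one, mul_zero,
    EmbeddingLike.apply_eq_iff_eq, Matrix.vecCons_inj, and_true] at hc
  obtain ⟨⟨h00, h01⟩, h10, h11⟩ := hc
  rw [Matrix.trace_fin_two_of]
  simp only [Matrix.of_apply, Matrix.cons_val', Matrix.cons_val_zero, Matrix.cons_val_one,
    Matrix.cons_val_fin_one] at hn
  by_contra hk
  refine hn ⟨?_, ?_, ?_⟩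
  · refine (mul_eq_zero.1 ?_).resolve_left hk
    linear_combination h01
  · refine (mul_eq_zero.1 ?_).resolve_left hk
    linear_combination h10
  · refine sub_eq_zero.1 ((mul_eq_zero.1 ?_).resolve_left hk)
    linear_combination h00 - h11

lemma exists_sq_add_sq_of_trace_eq_zero {A B : Matrix (Fin 2) (Fin 2) F} (hA : A.trace = 0)
    (hB : B.trace = 0) (hAB : (A * B).trace = 0) (dA : A.det = 1) (dB : B.det = 1) :
    ∃ a b : F, a ^ 2 + b ^ 2 = -1 := by
  obtain ⟨p, q, r, t, rfl⟩ : ∃ p q r t, A = !![p, q; r, t] := ⟨_, _, _, _, A.eta_fin_two⟩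
  obtain ⟨x, y, z, w, rfl⟩ : ∃ x y z w, B = !![x, y; z, w] := ⟨_, _, _, _, B.eta_fin_two⟩
  rw [Matrix.mul_fin_two] at hAB
  rw [Matrix.trace_fin_two_of] at hA hB hAB
  rw [Matrix.det_fin_two_of] at dA dB
  obtain rfl : t = -p := by linear_combination hA
  obtain rfl : w = -x := by linear_combination hB
  rcases eq_or_ne q 0 with rfl | hq
  · exact ⟨p, 0, by linear_combination -dA⟩
  · refine ⟨x - p * (y / q), y / q, ?_⟩
    field_simp
    linear_combination -q ^ 2 * dB - y ^ 2 * dA - y * q * hAB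

lemma exists_sq_add_sq_of_permuted_involutions {x y z : PGL2 F} (hx : x ^ 2 = 1) (hy : y ^ 2 = 1)
    (hxy : (x * y) ^ 2 = 1) (hx1 : x ≠ 1) (hy1 : y ≠ 1) (hxy1 : x * y ≠ 1)
    (hzx : z * x = y * z) (hzy : z * y = x * y * z) : ∃ a b : F, a ^ 2 + b ^ 2 = -1 := by
  induction x using QuotientGroup.induction_on with | H A => ?_
  induction y using QuotientGroup.induction_on with | H B => ?_
  induction z using QuotientGroup.induction_on with | H C => ?_
  have tA := trace_eq_zero_of_sq hx hx1
  have tB := trace_eq_zero_of_sq hy hy1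
  rw [← QuotientGroup.mk_mul] at hxy hxy1
  have tAB := trace_eq_zero_of_sq hxy hxy1
  simp only [← QuotientGroup.mk_mul] at hzx hzy
  obtain ⟨l, hl⟩ := mk_eq_mk_iff_exists_smul.1 hzx.symm
  obtain ⟨m, hm⟩ := mk_eq_mk_iff_exists_smul.1 hzy.symm
  have dA : A.val.det ≠ 0 := A.det_ne_zero
  have dB : B.val.det ≠ 0 := B.det_ne_zero
  have dC : C.val.det ≠ 0 := C.det_ne_zero
  simp only [Units.val_mul] at hl hm tAB
  generalize A.val = A at *
  generalize B.val = B at *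
  generalize C.val = C at *
  have hl' := congrArg Matrix.det hl
  have hm' := congrArg Matrix.det hm
  simp only [Matrix.det_mul, Matrix.det_smul, Fintype.card_fin] at hl' hm'
  have h1 : A.det = l ^ 2 * B.det := mul_left_cancel₀ dC (by linear_combination hl')
  have h2 : m ^ 2 * A.det = 1 := mul_left_cancel₀ (mul_ne_zero dC dB) (by linear_combination -hm')
  refine exists_sq_add_sq_of_trace_eq_zero (A := m • A) (B := (m * l) • B) ?_ ?_ ?_ ?_ ?_
  · simp [tA]
  · simp [tB]
  · simp [tAB]
  · simp [h2]
  · simp only [Matrix.det_smul, Fintype.card_fin]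
    linear_combination h2 - m ^ 2 * h1

end Necessity

section Generators

/-- The 5-cycle `(0 1 2 3 4)`. -/
def fiveCycle : alternatingGroup (Fin 5) :=
  ⟨finRotate 5, Equiv.Perm.mem_alternatingGroup.2 (by decide)⟩

/-- The 3-cycle `(2 4 3)`. -/
def threeCycle : alternatingGroup (Fin 5) :=
  ⟨c[2, 4, 3], Equiv.Perm.mem_alternatingGroup.2 (by decide)⟩

/-- The double transposition `(1 4)(2 3)`. -/
def doubleSwap : alternatingGroup (Fin 5) :=
  ⟨c[1, 4] * c[2, 3], Equiv.Perm.mem_alternatingGroup.2 (by decide)⟩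

/-- The double transposition `(1 3)(2 4)`. -/
def doubleSwap' : alternatingGroup (Fin 5) :=
  ⟨c[1, 3] * c[2, 4], Equiv.Perm.mem_alternatingGroup.2 (by decide)⟩

lemma orderOf_fiveCycle : orderOf fiveCycle = 5 :=
  haveI : Fact (Nat.Prime 5) := ⟨Nat.prime_five⟩
  orderOf_eq_prime (by decide) (by decide)

lemma orderOf_threeCycle : orderOf threeCycle = 3 := orderOf_eq_prime (by decide) (by decide)

lemma orderOf_doubleSwap : orderOf doubleSwap = 2 := orderOf_eq_prime (by decide) (by decide)

lemma eq_top_of_generators_mem {H : Subgroup (alternatingGroup (Fin 5))} (h5 : fiveCycle ∈ H)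
    (h3 : threeCycle ∈ H) (h2 : doubleSwap ∈ H) : H = ⊤ := by
  have c5 := Subgroup.orderOf_dvd_natCard H h5
  have c3 := Subgroup.orderOf_dvd_natCard H h3
  have c2 := Subgroup.orderOf_dvd_natCard H h2
  rw [orderOf_fiveCycle] at c5
  rw [orderOf_threeCycle] at c3
  rw [orderOf_doubleSwap] at c2
  have hc : Nat.card (alternatingGroup (Fin 5)) = 60 := by
    rw [nat_card_alternatingGroup, Nat.card_fin]
    decide
  have hi := H.card_mul_index
  rw [hc] at hi
  obtain ⟨n, hn⟩ : 30 ∣ Nat.card H := by omega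
  have h2n : 2 = H.index * n := by
    rw [hn] at hi
    nlinarith
  rcases (Nat.dvd_prime Nat.prime_two).1 ⟨n, h2n⟩ with h | h
  · exact Subgroup.index_eq_one.1 h
  · refine (Subgroup.normal_of_index_eq_two h).eq_bot_or_eq_top.resolve_left fun hb => ?_
    rw [hb, Subgroup.mem_bot] at h5
    exact absurd h5 (by decide)

lemma exists_of_alternatingGroup_le {F : Type*} [Field F]
    {ι : alternatingGroup (Fin 5) →* PGL2 F} (hι : Function.Injective ι) :
    (∃ a b : F, a ^ 2 + b ^ 2 = -1) ∧ ∃ s : F, s ^ 2 = 5 := by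
  have ne_one {g} (hg : g ≠ 1) : ι g ≠ 1 := (map_ne_one_iff ι hι).2 hg
  constructor
  · refine exists_sq_add_sq_of_permuted_involutions (x := ι doubleSwap) (y := ι doubleSwap')
      (z := ι threeCycle) ?_ ?_ ?_ (ne_one (by decide)) (ne_one (by decide)) ?_ ?_ ?_ <;>
      simp only [← map_mul, ← map_pow]
    · rw [show doubleSwap ^ 2 = 1 by decide, map_one]
    · rw [show doubleSwap' ^ 2 = 1 by decide, map_one]
    · rw [show (doubleSwap * doubleSwap') ^ 2 = 1 by decide, map_one]
    · exact ne_one (by decide)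
    · rw [show threeCycle * doubleSwap = doubleSwap' * threeCycle by decide]
    · rw [show threeCycle * doubleSwap' = doubleSwap * doubleSwap' * threeCycle by decide]
  · refine exists_sq_eq_five_of_pow_five (x := ι fiveCycle) ?_ (ne_one (by decide))
    rw [← map_pow, show fiveCycle ^ 5 = 1 by decide, map_one]

end Generators

section Icosians

/-- Quaternions over `ℤ[√5]`; the scaled icosians live here. -/
abbrev Icosian := Quaternion (ℤ√5)

instance : DecidableEq Icosian := fun x y => decidable_of_iff
  (x.re = y.re ∧ x.imI = y.imI ∧ x.imJ = y.imJ ∧ x.imK = y.imK) Quaternion.ext_iff.symm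

/-- Powers (up to scalars) of an icosian inducing the 5-cycle `(0 1 2 3 4)`, of norm 16. -/
def cosetRep : Fin 5 → Icosian :=
  ![⟨4, 0, 0, 0⟩, ⟨⟨1, 1⟩, 0, ⟨-1, 1⟩, -2⟩, ⟨⟨1, -1⟩, 0, -2, ⟨1, 1⟩⟩,
    ⟨⟨1, -1⟩, 0, 2, ⟨-1, -1⟩⟩, ⟨⟨1, 1⟩, 0, ⟨1, -1⟩, 2⟩]

/-- The Hurwitz quaternion of norm 4 inducing the even permutation of `Fin 5` which fixes `0`
and has prescribed values at `1` and `2`. -/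
def tetrahedral : Fin 5 → Fin 5 → Icosian :=
  ![![0, 0, 0, 0, 0],
    ![0, 0, ⟨2, 0, 0, 0⟩, ⟨1, -1, -1, -1⟩, ⟨1, 1, 1, 1⟩],
    ![0, ⟨0, 0, 0, 2⟩, 0, ⟨1, 1, -1, -1⟩, ⟨1, 1, -1, 1⟩],
    ![0, ⟨1, -1, 1, 1⟩, ⟨1, -1, -1, 1⟩, 0, ⟨0, 0, 2, 0⟩],
    ![0, ⟨1, -1, 1, -1⟩, ⟨1, 1, 1, -1⟩, ⟨0, 2, 0, 0⟩, 0]]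

/-- An icosian of norm 64 inducing the given even permutation. -/
def icosian (g : alternatingGroup (Fin 5)) : Icosian :=
  cosetRep (g.val 0) * tetrahedral (g.val 1 - g.val 0) (g.val 2 - g.val 0)

lemma normSq_icosian : ∀ g, Quaternion.normSq (icosian g) = ⟨64, 0⟩ := by
  decide +kernel

/-- The quaternion `8`. -/
def eight : Icosian := ⟨⟨8, 0⟩, 0, 0, 0⟩

lemma icosian_fiveCycle_mul : ∀ h,
    icosian fiveCycle * icosian h = eight * icosian (fiveCycle * h) ∨
      icosian fiveCycle * icosian h = -eight * icosian (fiveCycle * h) := by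
  decide +kernel

lemma icosian_threeCycle_mul : ∀ h,
    icosian threeCycle * icosian h = eight * icosian (threeCycle * h) ∨
      icosian threeCycle * icosian h = -eight * icosian (threeCycle * h) := by
  decide +kernel

lemma icosian_doubleSwap_mul : ∀ h,
    icosian doubleSwap * icosian h = eight * icosian (doubleSwap * h) ∨
      icosian doubleSwap * icosian h = -eight * icosian (doubleSwap * h) := by
  decide +kernel

lemma icosian_one : icosian 1 = eight := by
  decide +kernel

lemma icosian_doubleSwap : icosian doubleSwap = ⟨0, ⟨8, 0⟩, 0, 0⟩ :=
  Quaternion.ext_iff.2 (by decide +kernel)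

lemma eight_eq_algebraMap : eight = algebraMap (ℤ√5) Icosian 8 := by
  decide +kernel

end Icosians

section Sufficiency

variable {F : Type*} [Field F]

/-- The quaternion basis of the `2 × 2` matrices given by a solution of `a ^ 2 + b ^ 2 = -1`. -/
def matrixBasis {R : Type*} [CommRing R] [Algebra R F] {a b : F} (h : a ^ 2 + b ^ 2 = -1) :
    QuaternionAlgebra.Basis (Matrix (Fin 2) (Fin 2) F) (-1 : R) 0 (-1) where
  i := !![0, -1; 1, 0]
  j := !![a, b; b, -a]
  k := !![-b, a; a, b]
  i_mul_i := by simp [Matrix.one_fin_two]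
  j_mul_j := by
    have h₁ : a * a + b * b = -1 := by linear_combination h
    have h₂ : b * b + a * a = -1 := by linear_combination h
    simp [Matrix.one_fin_two, h₁, h₂, mul_comm]
  i_mul_j := by simp
  j_mul_i := by simp

variable [Algebra (ℤ√5) F] {a b : F}

/-- The matrix representing a quaternion. -/
def toMatrix (h : a ^ 2 + b ^ 2 = -1) : Icosian →ₐ[ℤ√5] Matrix (Fin 2) (Fin 2) F :=
  (matrixBasis h).liftHom

lemma toMatrix_eight (h : a ^ 2 + b ^ 2 = -1) :
    toMatrix h eight = (8 : F) • (1 : Matrix (Fin 2) (Fin 2) F) := by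
  rw [eight_eq_algebraMap, AlgHom.commutes, map_ofNat, ← Algebra.algebraMap_eq_smul_one, map_ofNat]

variable [CharZero F]

lemma det_toMatrix_icosian_ne_zero (h : a ^ 2 + b ^ 2 = -1) (g : alternatingGroup (Fin 5)) :
    (toMatrix h (icosian g)).det ≠ 0 := by
  have hn : icosian g * star (icosian g) = algebraMap (ℤ√5) Icosian 64 := by
    rw [Quaternion.self_mul_star, normSq_icosian]
    rfl
  have hm := congrArg (fun q => (toMatrix h q).det) hn
  simp only [map_mul, Matrix.det_mul, AlgHom.commutes, Matrix.algebraMap_eq_diagonal] at hm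
  refine left_ne_zero_of_mul (hm.trans_ne ?_)
  simp [map_ofNat]

/-- The element of `PGL₂` represented by an icosian inducing the given permutation. -/
noncomputable def ofIcosian (h : a ^ 2 + b ^ 2 = -1) (g : alternatingGroup (Fin 5)) : PGL2 F :=
  QuotientGroup.mk (Matrix.GeneralLinearGroup.mkOfDetNeZero _ (det_toMatrix_icosian_ne_zero h g))

lemma ofIcosian_mul_of_eq (h : a ^ 2 + b ^ 2 = -1) {g k : alternatingGroup (Fin 5)}
    (hgk : icosian g * icosian k = eight * icosian (g * k) ∨
      icosian g * icosian k = -eight * icosian (g * k)) :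
    ofIcosian h (g * k) = ofIcosian h g * ofIcosian h k := by
  rw [ofIcosian, ofIcosian, ofIcosian, ← QuotientGroup.mk_mul, mk_eq_mk_iff_exists_smul]
  simp only [Units.val_mul]
  rcases hgk with hgk | hgk
  · refine ⟨8, (map_mul (toMatrix h) _ _).symm.trans ?_⟩
    rw [hgk, map_mul, toMatrix_eight, smul_one_mul]
    rfl
  · refine ⟨-8, (map_mul (toMatrix h) _ _).symm.trans ?_⟩
    rw [hgk, map_mul, map_neg, toMatrix_eight, ← neg_smul, smul_one_mul]
    rfl

lemma ofIcosian_one (h : a ^ 2 + b ^ 2 = -1) : ofIcosian h 1 = (1 : PGL2 F) := by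
  refine ((QuotientGroup.mk_one _).symm.trans (mk_eq_mk_iff_exists_smul.2 ⟨8, ?_⟩)).symm
  change toMatrix h (icosian 1) = _
  rw [icosian_one, toMatrix_eight]
  rfl

lemma ofIcosian_mul (h : a ^ 2 + b ^ 2 = -1) (g k : alternatingGroup (Fin 5)) :
    ofIcosian h (g * k) = ofIcosian h g * ofIcosian h k := by
  let H : Subgroup (alternatingGroup (Fin 5)) :=
    { carrier := {g | ∀ k, ofIcosian h (g * k) = ofIcosian h g * ofIcosian h k}
      one_mem' := fun k => by rw [one_mul, ofIcosian_one, one_mul]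
      mul_mem' := fun {x y} hx hy k => by rw [mul_assoc, hx, hy, hx, mul_assoc]
      inv_mem' := fun {x} hx k => by
        have h1 := hx x⁻¹
        have h2 := hx (x⁻¹ * k)
        rw [mul_inv_cancel, ofIcosian_one] at h1
        rw [mul_inv_cancel_left] at h2
        rw [h2, ← mul_assoc, mul_eq_one_comm.1 h1.symm, one_mul] }
  have hH : H = ⊤ := eq_top_of_generators_mem
    (fun k => ofIcosian_mul_of_eq h (icosian_fiveCycle_mul k))
    (fun k => ofIcosian_mul_of_eq h (icosian_threeCycle_mul k))
    (fun k => ofIcosian_mul_of_eq h (icosian_doubleSwap_mul k))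
  have hg : g ∈ H := hH ▸ Subgroup.mem_top g
  exact hg k

lemma ofIcosian_doubleSwap_ne_one (h : a ^ 2 + b ^ 2 = -1) :
    ofIcosian h doubleSwap ≠ (1 : PGL2 F) := by
  intro h1
  obtain ⟨c, hc⟩ := exists_smul_one_of_mk_eq_one h1
  change (matrixBasis h).lift (icosian doubleSwap) = _ at hc
  have h10 := congrFun₂ hc 1 0
  have h8 : algebraMap (ℤ√5) F ⟨8, 0⟩ = 8 := map_ofNat _ 8
  simp [icosian_doubleSwap, QuaternionAlgebra.Basis.lift, matrixBasis,
    Algebra.smul_def (A := F), h8] at h10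

lemma exists_injective_of_algebra (h : a ^ 2 + b ^ 2 = -1) :
    ∃ ι : alternatingGroup (Fin 5) →* PGL2 F, Function.Injective ι := by
  refine ⟨MonoidHom.mk' (ofIcosian h) (ofIcosian_mul h), (MonoidHom.ker_eq_bot_iff _).1 ?_⟩
  refine (MonoidHom.normal_ker _).eq_bot_or_eq_top.resolve_right fun ht => ?_
  exact ofIcosian_doubleSwap_ne_one h (MonoidHom.mem_ker.1 (ht ▸ Subgroup.mem_top doubleSwap))

end Sufficiency

end PGL2

/-- For a field `F` of characteristic zero, `PGL₂(F)` contains a copy of `A₅` if and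
only if `-1` is a sum of two squares in `F` and `5` is a square in `F`. -/
theorem pgl2_contains_A5_iff (F : Type*) [Field F] [CharZero F] :
    (∃ H : Subgroup (PGL2 F), Nonempty (H ≃* alternatingGroup (Fin 5))) ↔
      ((∃ a b : F, a ^ 2 + b ^ 2 = -1) ∧ (∃ s : F, s ^ 2 = 5)) := by
  constructor
  · rintro ⟨H, ⟨e⟩⟩
    exact PGL2.exists_of_alternatingGroup_le
      (ι := H.subtype.comp e.symm.toMonoidHom) (H.subtype_injective.comp e.symm.injective)
  · rintro ⟨⟨a, b, h⟩, s, hs⟩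
    have hs' : s * s = ((5 : ℤ) : F) := by rw [← pow_two, hs, Int.cast_ofNat]
    let _ : Algebra (ℤ√5) F := (Zsqrtd.lift ⟨s, hs'⟩).toAlgebra
    obtain ⟨ι, hι⟩ := PGL2.exists_injective_of_algebra h
    exact ⟨ι.range, ⟨(MonoidHom.ofInjective hι).symm⟩⟩
end

section
/- Let F be a field of characteristic zero and r a positive integer. Then PGL₂(F) contains an element of order r if and only if there exists a primitive r-th root of unity ζ in an algebraic closure of F such that ζ + ζ⁻¹ lies in (the image of) F. -/
open scoped MatrixGroups

/-- A `2 × 2` matrix is scalar iff its off-diagonal entries vanish and its diagonal entries agree. -/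
lemma mem_range_scalar_fin_two_iff {R : Type*} [CommRing R] (M : Matrix (Fin 2) (Fin 2) R) :
    M ∈ Set.range (Matrix.scalar (Fin 2)) ↔ M 0 1 = 0 ∧ M 1 0 = 0 ∧ M 0 0 = M 1 1 := by
  constructor
  · rintro ⟨a, rfl⟩
    simp
  · rintro ⟨h01, h10, h⟩
    refine ⟨M 1 1, ?_⟩
    ext i j
    fin_cases i <;> fin_cases j <;> simp [h01, h10, h]

/-- An element of `GL₂(F)` is central iff its image over an extension is a scalar matrix. -/
lemma mem_center_iff_map_mem_range_scalar {F K : Type*} [Field F] [Field K] [Algebra F K]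
    (g : GL (Fin 2) F) :
    g ∈ Subgroup.center (GL (Fin 2) F) ↔
      (algebraMap F K).mapMatrix g.val ∈ Set.range (Matrix.scalar (Fin 2)) := by
  rw [Matrix.GeneralLinearGroup.mem_center_iff_val_mem_range_scalar,
    mem_range_scalar_fin_two_iff, mem_range_scalar_fin_two_iff]
  simp

/-- The Cayley–Hamilton theorem for `2 × 2` matrices. -/
lemma sq_eq_smul_sub_smul_one {R : Type*} [CommRing R] (M : Matrix (Fin 2) (Fin 2) R) {a b : R}
    (htr : a + b = M.trace) (hdet : a * b = M.det) :
    M * M = (a + b) • M - (a * b) • (1 : Matrix (Fin 2) (Fin 2) R) := by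
  rw [htr, hdet, Matrix.trace_fin_two, Matrix.det_fin_two]
  ext i j
  fin_cases i <;> fin_cases j <;> simp [Matrix.mul_apply, Fin.sum_univ_two] <;> ring

lemma sub_smul_pow_eq {R : Type*} [CommRing R] (M : Matrix (Fin 2) (Fin 2) R) {a b : R}
    (htr : a + b = M.trace) (hdet : a * b = M.det) (n : ℕ) :
    (a - b) • M ^ n = (a ^ n - b ^ n) • M + (a * b ^ n - b * a ^ n) •
      (1 : Matrix (Fin 2) (Fin 2) R) := by
  induction n with
  | zero => simp
  | succ n ih =>
    rw [pow_succ, ← smul_mul_assoc, ih, add_mul, smul_mul_assoc, smul_mul_assoc, one_mul,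
      sq_eq_smul_sub_smul_one M htr hdet]
    module

lemma pow_succ_eq_of_eigenvalues_eq {R : Type*} [CommRing R] (M : Matrix (Fin 2) (Fin 2) R) {a : R}
    (htr : a + a = M.trace) (hdet : a * a = M.det) (n : ℕ) :
    M ^ (n + 1) = ((n + 1) * a ^ n) • M - (n * a ^ (n + 1)) •
      (1 : Matrix (Fin 2) (Fin 2) R) := by
  induction n with
  | zero => simp
  | succ n ih =>
    rw [pow_succ, ih, sub_mul, smul_mul_assoc, smul_mul_assoc, one_mul,
      sq_eq_smul_sub_smul_one M htr hdet]
    push_cast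
    module

/-- If `M` has distinct eigenvalues `a` and `b`, then `M ^ n` is scalar iff `a ^ n = b ^ n`. -/
lemma pow_mem_range_scalar_iff {K : Type*} [Field K] (M : Matrix (Fin 2) (Fin 2) K) {a b : K}
    (htr : a + b = M.trace) (hdet : a * b = M.det) (hab : a ≠ b) (n : ℕ) :
    M ^ n ∈ Set.range (Matrix.scalar (Fin 2)) ↔ a ^ n = b ^ n := by
  have hsub : a - b ≠ 0 := sub_ne_zero.mpr hab
  have h := sub_smul_pow_eq M htr hdet n
  have h00 := congrFun (congrFun h 0) 0
  have h01 := congrFun (congrFun h 0) 1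
  have h10 := congrFun (congrFun h 1) 0
  have h11 := congrFun (congrFun h 1) 1
  simp at h00 h01 h10 h11
  rw [mem_range_scalar_fin_two_iff]
  constructor
  · rintro ⟨e01, e10, e⟩
    by_contra hne
    have hne' : a ^ n - b ^ n ≠ 0 := sub_ne_zero.mpr hne
    have m01 : M 0 1 = 0 := by simpa [e01, hne'] using h01
    have hm : M 0 0 = M 1 1 := by
      apply mul_left_cancel₀ hne'
      linear_combination h11 - h00 + (a - b) * e
    rw [Matrix.trace_fin_two, hm] at htr
    rw [Matrix.det_fin_two, hm, m01] at hdet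
    refine hsub (pow_eq_zero_iff two_ne_zero |>.mp ?_)
    linear_combination (a + b + M 1 1 + M 1 1) * htr - 4 * hdet
  · intro e
    rw [e] at h00 h01 h10 h11
    simp only [sub_self, zero_mul, zero_add, mul_eq_zero, hsub, false_or] at h01 h10 h00 h11
    exact ⟨h01, h10, mul_left_cancel₀ hsub (h00.trans h11.symm)⟩

/-- In characteristic zero, if `M` has a nonzero double eigenvalue and some positive power of `M`
is scalar, then `M` is scalar. -/
lemma mem_range_scalar_of_pow {K : Type*} [Field K] [CharZero K] (M : Matrix (Fin 2) (Fin 2) K)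
    {a : K} (htr : a + a = M.trace) (hdet : a * a = M.det) (ha : a ≠ 0) {n : ℕ} (hn : 0 < n)
    (h : M ^ n ∈ Set.range (Matrix.scalar (Fin 2))) :
    M ∈ Set.range (Matrix.scalar (Fin 2)) := by
  obtain ⟨n, rfl⟩ := Nat.exists_eq_add_of_lt hn
  rw [zero_add, pow_succ_eq_of_eigenvalues_eq M htr hdet, mem_range_scalar_fin_two_iff] at h
  rw [mem_range_scalar_fin_two_iff]
  have hc : ((n : K) + 1) * a ^ n ≠ 0 := mul_ne_zero n.cast_add_one_ne_zero (pow_ne_zero n ha)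
  obtain ⟨h01, h10, h⟩ := h
  simp only [Matrix.sub_apply, Matrix.smul_apply, smul_eq_mul, Matrix.one_apply_eq] at h
  refine ⟨?_, ?_, mul_left_cancel₀ hc (by linear_combination h)⟩
  · simpa [-mul_eq_zero, mul_eq_zero_iff_left hc] using h01
  · simpa [-mul_eq_zero, mul_eq_zero_iff_left hc] using h10

/-- The order in `PGL₂(F)` of a matrix with distinct eigenvalues `a` and `b` is the order of
`a / b`. -/
lemma orderOf_mk_eq_orderOf_div {F K : Type*} [Field F] [Field K] [Algebra F K]
    (g : GL (Fin 2) F) {a b : K} (htr : a + b = algebraMap F K g.val.trace)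
    (hdet : a * b = algebraMap F K g.val.det) (hab : a ≠ b) :
    orderOf (g : PGL2 F) = orderOf (a / b) := by
  have hb : b ≠ 0 := by
    rintro rfl
    rw [mul_zero, eq_comm] at hdet
    exact (map_ne_zero _).mpr (g.isUnit.map Matrix.detMonoidHom).ne_zero hdet
  rw [orderOf_eq_orderOf_iff]
  intro n
  rw [← QuotientGroup.mk_pow, QuotientGroup.eq_one_iff,
    mem_center_iff_map_mem_range_scalar (K := K), Units.val_pow_eq_pow_val, map_pow,
    pow_mem_range_scalar_iff (a := a) (b := b) _ _ _ hab, div_pow,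
    div_eq_one_iff_eq (pow_ne_zero n hb)]
  · rw [htr]
    simp [Matrix.trace_fin_two]
  · rw [hdet, RingHom.map_det]

lemma exists_add_mul_eq {K : Type*} [Field K] [IsAlgClosed K] (t d : K) :
    ∃ a b : K, a + b = t ∧ a * b = d := by
  have hdeg : (Polynomial.X ^ 2 - Polynomial.C t * Polynomial.X + Polynomial.C d).degree ≠ 0 := by
    have : (Polynomial.X ^ 2 - Polynomial.C t * Polynomial.X + Polynomial.C d).degree = 2 := by
      compute_degree!
    simp [this]
  obtain ⟨a, ha⟩ := IsAlgClosed.exists_root _ hdeg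
  simp at ha
  exact ⟨a, t - a, by ring, by linear_combination -ha⟩

/-- For a field `F` of characteristic zero and a positive integer `r`, `PGL₂(F)` contains
an element of order `r` if and only if `ζ + ζ⁻¹` lies in (the image of) `F` for some
primitive `r`-th root of unity `ζ` in an algebraic closure of `F`. -/
theorem pgl2_contains_element_of_order_iff (F : Type*) [Field F] [CharZero F]
    (r : ℕ) (hr : 0 < r) :
    (∃ g : PGL2 F, orderOf g = r) ↔
      ∃ ζ : AlgebraicClosure F, IsPrimitiveRoot ζ r ∧
        ζ + ζ⁻¹ ∈ Set.range (algebraMap F (AlgebraicClosure F)) := by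
  constructor
  · rintro ⟨x, hx⟩
    obtain ⟨g, rfl⟩ := QuotientGroup.mk_surjective x
    obtain ⟨a, b, htr, hdet⟩ := exists_add_mul_eq (algebraMap F (AlgebraicClosure F) g.val.trace)
      (algebraMap F (AlgebraicClosure F) g.val.det)
    have hd : algebraMap F (AlgebraicClosure F) g.val.det ≠ 0 :=
      (map_ne_zero _).mpr (g.isUnit.map Matrix.detMonoidHom).ne_zero
    have ha : a ≠ 0 := left_ne_zero_of_mul (hdet ▸ hd)
    have hb : b ≠ 0 := right_ne_zero_of_mul (hdet ▸ hd)
    by_cases hab : a = b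
    · subst hab
      have hpow : (g : PGL2 F) ^ r = 1 := hx ▸ pow_orderOf_eq_one _
      rw [← QuotientGroup.mk_pow, QuotientGroup.eq_one_iff,
        mem_center_iff_map_mem_range_scalar (K := AlgebraicClosure F), Units.val_pow_eq_pow_val, map_pow] at hpow
      have hg := mem_range_scalar_of_pow _ (by rw [htr]; simp [Matrix.trace_fin_two])
        (by rw [hdet, RingHom.map_det]) ha hr hpow
      rw [← mem_center_iff_map_mem_range_scalar, ← QuotientGroup.eq_one_iff] at hg
      rw [hg, orderOf_one] at hx
      exact ⟨1, hx ▸ IsPrimitiveRoot.one, 1 + 1, by simp⟩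
    · refine ⟨a / b, ?_, (g.val.trace ^ 2 - 2 * g.val.det) / g.val.det, ?_⟩
      · rw [← hx, orderOf_mk_eq_orderOf_div g htr hdet hab]
        exact IsPrimitiveRoot.orderOf _
      · rw [map_div₀, map_sub, map_mul, map_pow, map_ofNat, ← htr, ← hdet]
        field_simp
        ring
  · rintro ⟨ζ, hζ, c, hc⟩
    have hζ0 : ζ ≠ 0 := hζ.ne_zero hr.ne'
    by_cases h1 : ζ = 1
    · subst h1
      exact ⟨1, by rw [orderOf_one, hζ.eq_orderOf, orderOf_one]⟩
    by_cases h2 : ζ = -1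
    · refine ⟨(Matrix.GeneralLinearGroup.mkOfDetNeZero !![-1, 0; 0, 1] (by simp) : GL (Fin 2) F), ?_⟩
      rw [orderOf_mk_eq_orderOf_div (K := AlgebraicClosure F) (a := ζ) (b := 1), div_one,
        hζ.eq_orderOf]
      · simp [Matrix.GeneralLinearGroup.mkOfDetNeZero, h2]
      · simp [Matrix.GeneralLinearGroup.mkOfDetNeZero, h2]
      · exact h1
    have hζ1 : 1 + ζ ≠ 0 := fun h ↦ h2 (by linear_combination h)
    have h_two : algebraMap F (AlgebraicClosure F) 2 = 2 := map_ofNat _ 2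
    have hd : algebraMap F (AlgebraicClosure F) (2 + c) = (1 + ζ) * (1 + ζ⁻¹) := by
      rw [map_add, hc, h_two]
      field_simp
      ring
    have hζ1' : 1 + ζ⁻¹ ≠ 0 := by
      intro h
      field_simp at h
      exact hζ1 (by linear_combination h)
    have hd0 : 2 + c ≠ 0 := by
      intro h
      rw [h, map_zero] at hd
      exact mul_ne_zero hζ1 hζ1' hd.symm
    refine ⟨(Matrix.GeneralLinearGroup.mkOfDetNeZero !![0, -(2 + c); 1, 2 + c]
      (by simpa [Matrix.det_fin_two] using hd0) : GL (Fin 2) F), ?_⟩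
    have hdiv : (1 + ζ) / (1 + ζ⁻¹) = ζ := by
      rw [div_eq_iff hζ1']
      field_simp
      ring
    rw [orderOf_mk_eq_orderOf_div (K := AlgebraicClosure F) (a := 1 + ζ) (b := 1 + ζ⁻¹), hdiv,
      hζ.eq_orderOf]
    · simp only [Matrix.GeneralLinearGroup.mkOfDetNeZero, Matrix.trace_fin_two]
      simp [hc, h_two]
      ring
    · simp only [Matrix.GeneralLinearGroup.mkOfDetNeZero, Matrix.det_fin_two]
      simp [hc, h_two]
      field_simp
      ring
    · intro h
      rw [h, div_self hζ1'] at hdiv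
      exact h1 hdiv.symm
end
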